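/- arXiv:math/0005150 — 3 statements merged into one kernel-verified Lean document; each statement's English description precedes it below -/
import Mathlib

section
/- (Commutative case of Lemma 3.3.) Let (Ω, μ) be a probability space, 1 ≤ p < 2, 0 < ε < η/2, n ≥ 1, and let f_1, …, f_n ∈ L^p(μ) with ‖f_i‖_{L^p(μ)} ≤ 1 for all i, such that (f_1, …, f_n) is u-unconditional. Suppose there are δ_1 ≥ δ_2 ≥ ⋯ ≥ δ_n > 0 such that for all 1 ≤ j ≤ n one has ω_p(f_j, δ_j) > η, and for all j < k ≤ n one has ω_p(f_j, δ_k + δ_{k+1} + ⋯ + δ_n) < ε/2. Then (f_1, …, f_n) is C-equivalent to the usual ℓ^p_n basis, where C ≤ u·√3·(η/2 − ε)^{-1}. -/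
open MeasureTheory Filter
open scoped ENNReal NNReal BigOperators

noncomputable section

variable {E : Type*} [NormedAddCommGroup E] [NormedSpace ℝ E]

/-- `x` is `K`-equivalent to the usual `ℓ^q` basis. -/
def IsLqBasisEquiv (q K : ℝ) (x : ℕ → E) : Prop :=
  ∀ (s : Finset ℕ) (a : ℕ → ℝ),
    (1 / K) * (∑ k ∈ s, |a k| ^ q) ^ (1 / q) ≤ ‖∑ k ∈ s, a k • x k‖ ∧
      ‖∑ k ∈ s, a k • x k‖ ≤ K * (∑ k ∈ s, |a k| ^ q) ^ (1 / q)

/-- `x` is `K`-equivalent to the usual `ℓ^q_n` basis. -/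
def IsLqBasisEquivFin (q K : ℝ) {n : ℕ} (x : Fin n → E) : Prop :=
  ∀ a : Fin n → ℝ,
    (1 / K) * (∑ k, |a k| ^ q) ^ (1 / q) ≤ ‖∑ k, a k • x k‖ ∧
      ‖∑ k, a k • x k‖ ≤ K * (∑ k, |a k| ^ q) ^ (1 / q)

/-- `x` is `u`-unconditional. -/
def IsUnconditionalWith (u : ℝ) (x : ℕ → E) : Prop :=
  ∀ (s : Finset ℕ) (c ε : ℕ → ℝ), (∀ k ∈ s, |ε k| = 1) →
    ‖∑ k ∈ s, (ε k * c k) • x k‖ ≤ u * ‖∑ k ∈ s, c k • x k‖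

/-- `x` is unconditional. -/
def IsUnconditional (x : ℕ → E) : Prop :=
  ∃ u : ℝ, 1 ≤ u ∧ IsUnconditionalWith u x

/-- Finite version of `u`-unconditionality. -/
def IsUnconditionalWithFin (u : ℝ) {n : ℕ} (x : Fin n → E) : Prop :=
  ∀ (c ε : Fin n → ℝ), (∀ k, |ε k| = 1) →
    ‖∑ k, (ε k * c k) • x k‖ ≤ u * ‖∑ k, c k • x k‖

/-- The measure `μ` is atomless: every measurable set of positive measure contains a
measurable subset of strictly smaller positive measure. -/
def Atomless {Ω : Type*} [MeasurableSpace Ω] (μ : Measure Ω) : Prop :=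
  ∀ A : Set Ω, MeasurableSet A → 0 < μ A →
    ∃ B, B ⊆ A ∧ MeasurableSet B ∧ 0 < μ B ∧ μ B < μ A

/-- The family `(|f n|^p)` is uniformly integrable. -/
def UnifIntPow {Ω : Type*} [MeasurableSpace Ω] (μ : Measure Ω) (p : ℝ) (f : ℕ → Ω → ℝ) : Prop :=
  ∀ ε : ℝ, 0 < ε → ∃ δ : ℝ, 0 < δ ∧ ∀ n, ∀ A : Set Ω, MeasurableSet A →
    μ A ≤ ENNReal.ofReal δ → ∫ x in A, |f n x| ^ p ∂μ ≤ ε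

/-- `(f n)` is weakly null in `L^p(μ)`. -/
def WeaklyNullLp {Ω : Type*} [MeasurableSpace Ω] (μ : Measure Ω) (p : ℝ≥0∞)
    (f : ℕ → Lp ℝ p μ) : Prop :=
  ∀ q : ℝ≥0∞, p⁻¹ + q⁻¹ = 1 → ∀ g : Lp ℝ q μ,
    Tendsto (fun n => ∫ x, (f n : Ω → ℝ) x * (g : Ω → ℝ) x ∂μ) atTop (nhds 0)

/-- The `p`-modulus of uniform integrability. -/
def omegaP {Ω : Type*} [MeasurableSpace Ω] (μ : Measure Ω) (p : ℝ) (f : Ω → ℝ) (ε : ℝ) : ℝ :=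
  sSup {r : ℝ | ∃ A : Set Ω, MeasurableSet A ∧ μ A ≤ ENNReal.ofReal ε ∧
    r = (∫ x in A, |f x| ^ p ∂μ) ^ (1 / p)}


section LpSigns

variable {Ω : Type*} [MeasurableSpace Ω] {μ : Measure Ω}

theorem abs_add_rpow_add_abs_sub_rpow_le {p : ℝ} (hp1 : 1 ≤ p) (hp2 : p ≤ 2) (x y : ℝ) :
    |x + y| ^ p + |x - y| ^ p ≤ 2 * (|x| ^ p + |y| ^ p) := by
  have key : ∀ z : ℝ, |z| ^ p = (z ^ 2) ^ (p / 2) := fun z => by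
    rw [← sq_abs, ← Real.rpow_natCast, ← Real.rpow_mul (abs_nonneg z)]
    congr 1
    push_cast
    ring
  have hc := (Real.concaveOn_rpow (p := p / 2) (by linarith) (by linarith)).2
    (Set.mem_Ici.2 (sq_nonneg (x + y))) (Set.mem_Ici.2 (sq_nonneg (x - y)))
    (by norm_num : (0 : ℝ) ≤ 1 / 2) (by norm_num : (0 : ℝ) ≤ 1 / 2) (by norm_num)
  have hs := Real.rpow_add_le_add_rpow (sq_nonneg x) (sq_nonneg y) (p := p / 2)
    (by linarith) (by linarith)
  simp only [smul_eq_mul] at hc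
  rw [show 1 / 2 * (x + y) ^ 2 + 1 / 2 * (x - y) ^ 2 = x ^ 2 + y ^ 2 by ring] at hc
  simp only [key]
  linarith

theorem two_mul_abs_rpow_le {p : ℝ} (hp1 : 1 ≤ p) {x y z : ℝ} (h : x + y = 2 * z) :
    2 * |z| ^ p ≤ |x| ^ p + |y| ^ p := by
  have hc := (convexOn_rpow hp1).2 (Set.mem_Ici.2 (abs_nonneg x)) (Set.mem_Ici.2 (abs_nonneg y))
    (by norm_num : (0 : ℝ) ≤ 1 / 2) (by norm_num : (0 : ℝ) ≤ 1 / 2) (by norm_num)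
  simp only [smul_eq_mul] at hc
  have hz : |z| ≤ 1 / 2 * |x| + 1 / 2 * |y| := by
    have := abs_add_le x y
    rw [h, abs_mul, abs_two] at this
    linarith
  have := Real.rpow_le_rpow (abs_nonneg z) hz (by linarith : 0 ≤ p)
  linarith

theorem integrable_abs_rpow_Lp {p : ℝ} (hp1 : 1 ≤ p) (g : Lp ℝ (ENNReal.ofReal p) μ) :
    Integrable (fun x => |g x| ^ p) μ := by
  have h := (Lp.memLp g).integrable_norm_rpow (by simp; linarith) ENNReal.ofReal_ne_top
  rwa [ENNReal.toReal_ofReal (by linarith)] at h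

theorem Lp_norm_rpow_eq_integral {p : ℝ} (hp1 : 1 ≤ p) (g : Lp ℝ (ENNReal.ofReal p) μ) :
    ‖g‖ ^ p = ∫ x, |g x| ^ p ∂μ := by
  rw [Lp.norm_def, (Lp.memLp g).eLpNorm_eq_integral_rpow_norm (by simp; linarith)
    ENNReal.ofReal_ne_top, ENNReal.toReal_ofReal (by linarith : 0 ≤ p), ENNReal.toReal_ofReal
    (by positivity), ← Real.rpow_mul (by positivity), inv_mul_cancel₀ (by linarith), Real.rpow_one]
  rfl

theorem Lp_norm_add_rpow_add_norm_sub_rpow_le {p : ℝ} (hp1 : 1 ≤ p) (hp2 : p ≤ 2)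
    (f g : Lp ℝ (ENNReal.ofReal p) μ) :
    ‖f + g‖ ^ p + ‖f - g‖ ^ p ≤ 2 * (‖f‖ ^ p + ‖g‖ ^ p) := by
  simp only [Lp_norm_rpow_eq_integral hp1]
  rw [← integral_add (integrable_abs_rpow_Lp hp1 _) (integrable_abs_rpow_Lp hp1 _),
    ← integral_add (integrable_abs_rpow_Lp hp1 _) (integrable_abs_rpow_Lp hp1 _),
    ← integral_const_mul]
  refine integral_mono_ae
    ((integrable_abs_rpow_Lp hp1 _).add (integrable_abs_rpow_Lp hp1 _))
    (((integrable_abs_rpow_Lp hp1 _).add (integrable_abs_rpow_Lp hp1 _)).const_mul 2) ?_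
  filter_upwards [Lp.coeFn_add f g, Lp.coeFn_sub f g] with x h1 h2
  simp only [h1, h2, Pi.add_apply, Pi.sub_apply]
  exact abs_add_rpow_add_abs_sub_rpow_le hp1 hp2 _ _

theorem exists_signs_norm_sum_rpow_le {ι : Type*} {p : ℝ} (hp1 : 1 ≤ p) (hp2 : p ≤ 2)
    (g : ι → Lp ℝ (ENNReal.ofReal p) μ) (s : Finset ι) :
    ∃ σ : ι → ℝ, (∀ k, |σ k| = 1) ∧ ‖∑ k ∈ s, σ k • g k‖ ^ p ≤ ∑ k ∈ s, ‖g k‖ ^ p := by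
  classical
  induction s using Finset.induction_on with
  | empty => exact ⟨fun _ => 1, by simp, by simp [Real.zero_rpow (by linarith : p ≠ 0)]⟩
  | insert j s hj ih =>
    obtain ⟨σ, hσ, hle⟩ := ih
    have upd : ∀ t : ℝ, ∑ k ∈ insert j s, Function.update σ j t k • g k =
        (∑ k ∈ s, σ k • g k) + t • g j := fun t => by
      rw [Finset.sum_insert hj, Function.update_self, add_comm]
      congr 1
      refine Finset.sum_congr rfl fun k hk => ?_
      rw [Function.update_of_ne (ne_of_mem_of_not_mem hk hj)]
    have habs : ∀ t : ℝ, |t| = 1 → ∀ k, |Function.update σ j t k| = 1 := fun t ht k => by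
      by_cases h : k = j
      · subst h; simpa using ht
      · simpa [h] using hσ k
    have hcl := Lp_norm_add_rpow_add_norm_sub_rpow_le hp1 hp2 (∑ k ∈ s, σ k • g k) (g j)
    rw [Finset.sum_insert hj]
    by_cases h : ‖(∑ k ∈ s, σ k • g k) + g j‖ ^ p ≤
        ‖∑ k ∈ s, σ k • g k‖ ^ p + ‖g j‖ ^ p
    · refine ⟨Function.update σ j 1, habs 1 (by simp), ?_⟩
      rw [upd, one_smul]
      linarith
    · refine ⟨Function.update σ j (-1), habs (-1) (by simp), ?_⟩
      rw [upd, neg_one_smul, ← sub_eq_add_neg]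
      linarith

theorem sum_signs_abs_rpow_ge {ι : Type*} [Fintype ι] [DecidableEq ι] {p : ℝ} (hp1 : 1 ≤ p)
    (y : ι → ℝ) (j : ι) :
    (Fintype.card (ι → ℤˣ) : ℝ) * |y j| ^ p ≤
      ∑ σ : ι → ℤˣ, |∑ k, ((σ k : ℤ) : ℝ) * y k| ^ p := by
  set S : (ι → ℤˣ) → ℝ := fun σ => ∑ k, ((σ k : ℤ) : ℝ) * y k with hS
  let τ : ι → ℤˣ := fun k => if k = j then 1 else -1
  have hre : ∑ σ : ι → ℤˣ, |S (τ * σ)| ^ p = ∑ σ : ι → ℤˣ, |S σ| ^ p :=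
    Equiv.sum_comp (Equiv.mulLeft τ) fun σ => |S σ| ^ p
  have hadd : ∀ σ, S σ + S (τ * σ) = 2 * (((σ j : ℤ) : ℝ) * y j) := fun σ => by
    rw [hS, ← Finset.sum_add_distrib, Finset.sum_eq_single j]
    · simp [τ]; ring
    · intro k _ hk
      simp [τ, hk]
    · simp
  have habs : ∀ σ : ι → ℤˣ, |((σ j : ℤ) : ℝ) * y j| = |y j| := fun σ => by
    rcases Int.units_eq_one_or (σ j) with h | h <;> simp [h]
  have hsum : ∑ σ : ι → ℤˣ, 2 * |y j| ^ p ≤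
      ∑ σ : ι → ℤˣ, (|S σ| ^ p + |S (τ * σ)| ^ p) :=
    Finset.sum_le_sum fun σ _ => by
      rw [← habs σ]
      exact two_mul_abs_rpow_le hp1 (hadd σ)
  rw [Finset.sum_add_distrib, hre, Finset.sum_const, nsmul_eq_mul, Finset.card_univ] at hsum
  linarith

theorem sum_signs_norm_rpow_ge {ι : Type*} [Fintype ι] [DecidableEq ι] {p : ℝ} (hp1 : 1 ≤ p)
    (g : ι → Lp ℝ (ENNReal.ofReal p) μ) (B : ι → Set Ω) (hB : ∀ j, MeasurableSet (B j))
    (hdisj : Pairwise (Function.onFun Disjoint B)) :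
    (Fintype.card (ι → ℤˣ) : ℝ) * ∑ j, ∫ x in B j, |g j x| ^ p ∂μ ≤
      ∑ σ : ι → ℤˣ, ‖∑ k, ((σ k : ℤ) : ℝ) • g k‖ ^ p := by
  have hint : ∀ h : Lp ℝ (ENNReal.ofReal p) μ, Integrable (fun x => |h x| ^ p) μ :=
    integrable_abs_rpow_Lp hp1
  have hcoe : ∀ σ : ι → ℤˣ, ∀ᵐ x ∂μ,
      (∑ k, ((σ k : ℤ) : ℝ) • g k : Lp ℝ (ENNReal.ofReal p) μ) x =
        ∑ k, ((σ k : ℤ) : ℝ) * g k x := fun σ => by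
    have h2 : ∀ᵐ x ∂μ, ∀ k, (((σ k : ℤ) : ℝ) • g k : Lp ℝ (ENNReal.ofReal p) μ) x =
        ((σ k : ℤ) : ℝ) * g k x := ae_all_iff.2 fun k => by
      filter_upwards [Lp.coeFn_smul ((σ k : ℤ) : ℝ) (g k)] with x hx
      simpa using hx
    filter_upwards [Lp.coeFn_finsetSum Finset.univ fun k => ((σ k : ℤ) : ℝ) • g k, h2]
      with x h1 h2
    rw [h1, Finset.sum_apply]
    exact Finset.sum_congr rfl fun k _ => h2 k
  have hpt : ∀ᵐ x ∂μ, ∀ j, (Fintype.card (ι → ℤˣ) : ℝ) * |g j x| ^ p ≤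
      ∑ σ : ι → ℤˣ, |(∑ k, ((σ k : ℤ) : ℝ) • g k : Lp ℝ (ENNReal.ofReal p) μ) x| ^ p := by
    filter_upwards [ae_all_iff.2 hcoe] with x hx j
    simp only [hx]
    exact sum_signs_abs_rpow_ge hp1 (fun k => g k x) j
  set F : Ω → ℝ := fun x =>
    ∑ σ : ι → ℤˣ, |(∑ k, ((σ k : ℤ) : ℝ) • g k : Lp ℝ (ENNReal.ofReal p) μ) x| ^ p with hF
  have hFint : Integrable F μ := integrable_finsetSum _ fun σ _ => hint _
  calc (Fintype.card (ι → ℤˣ) : ℝ) * ∑ j, ∫ x in B j, |g j x| ^ p ∂μ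
      = ∑ j, ∫ x in B j, (Fintype.card (ι → ℤˣ) : ℝ) * |g j x| ^ p ∂μ := by
        rw [Finset.mul_sum]
        simp only [integral_const_mul]
    _ ≤ ∑ j, ∫ x in B j, F x ∂μ := Finset.sum_le_sum fun j _ => by
        refine integral_mono_ae ((hint _).integrableOn.const_mul _) hFint.integrableOn ?_
        filter_upwards [ae_restrict_of_ae hpt] with x hx using hx j
    _ = ∫ x in ⋃ j, B j, F x ∂μ :=
        (integral_iUnion_fintype hB hdisj fun j => hFint.integrableOn).symm
    _ ≤ ∫ x, F x ∂μ := setIntegral_le_integral hFint (ae_of_all _ fun x =>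
        Finset.sum_nonneg fun σ _ => Real.rpow_nonneg (abs_nonneg _) _)
    _ = _ := by
        rw [hF, integral_finsetSum _ fun σ _ => hint _]
        simp only [Lp_norm_rpow_eq_integral hp1]

theorem setIntegral_rpow_le_norm {p : ℝ} (hp1 : 1 ≤ p) (g : Lp ℝ (ENNReal.ofReal p) μ)
    (A : Set Ω) : (∫ x in A, |g x| ^ p ∂μ) ^ (1 / p) ≤ ‖g‖ := by
  have hp : 0 < p := by linarith
  have h0 : 0 ≤ ∫ x in A, |g x| ^ p ∂μ :=
    integral_nonneg fun x => Real.rpow_nonneg (abs_nonneg _) _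
  have hg : 0 ≤ ‖g‖ := ENNReal.toReal_nonneg
  rw [one_div, Real.rpow_inv_le_iff_of_pos h0 hg hp, Lp_norm_rpow_eq_integral hp1]
  exact setIntegral_le_integral (integrable_abs_rpow_Lp hp1 g)
    (ae_of_all _ fun x => Real.rpow_nonneg (abs_nonneg _) _)

theorem exists_rpow_lt_setIntegral_of_lt_omegaP {p : ℝ} (hp1 : 1 ≤ p) {f : Ω → ℝ} {η δ : ℝ}
    (hη : 0 ≤ η) (h : η < omegaP μ p f δ) :
    ∃ A, MeasurableSet A ∧ μ A ≤ ENNReal.ofReal δ ∧ η ^ p < ∫ x in A, |f x| ^ p ∂μ := by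
  obtain ⟨r, ⟨A, hA, hμ, rfl⟩, hr⟩ := exists_lt_of_lt_csSup
    (by exact ⟨_, ∅, MeasurableSet.empty, by simp, rfl⟩) h
  refine ⟨A, hA, hμ, ?_⟩
  rwa [one_div, Real.lt_rpow_inv_iff_of_pos hη
    (integral_nonneg fun x => Real.rpow_nonneg (abs_nonneg _) _) (by linarith)] at hr

theorem setIntegral_le_rpow_of_omegaP_le {p : ℝ} (hp1 : 1 ≤ p)
    (g : Lp ℝ (ENNReal.ofReal p) μ) {c δ : ℝ} (hc : 0 ≤ c) (h : omegaP μ p g δ ≤ c)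
    {A : Set Ω} (hA : MeasurableSet A) (hμ : μ A ≤ ENNReal.ofReal δ) :
    ∫ x in A, |g x| ^ p ∂μ ≤ c ^ p := by
  have hbdd : BddAbove {r : ℝ | ∃ A : Set Ω, MeasurableSet A ∧ μ A ≤ ENNReal.ofReal δ ∧
      r = (∫ x in A, |g x| ^ p ∂μ) ^ (1 / p)} :=
    ⟨‖g‖, by rintro _ ⟨A, -, -, rfl⟩; exact setIntegral_rpow_le_norm hp1 g A⟩
  have := (le_csSup hbdd ⟨A, hA, hμ, rfl⟩).trans h
  rwa [one_div, Real.rpow_inv_le_iff_of_pos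
    (integral_nonneg fun x => Real.rpow_nonneg (abs_nonneg _) _) hc (by linarith)] at this

theorem exists_disjoint_rpow_le_setIntegral {p : ℝ} (hp1 : 1 ≤ p) {ε η : ℝ} (hε : 0 < ε)
    (hεη : ε < η / 2) {n : ℕ} (f : Fin n → Lp ℝ (ENNReal.ofReal p) μ) (δ : Fin n → ℝ)
    (hδpos : ∀ i, 0 < δ i) (hbig : ∀ j, η < omegaP μ p (f j : Ω → ℝ) (δ j))
    (hsmall : ∀ j k : Fin n, j < k →
      omegaP μ p (f j : Ω → ℝ) (∑ m ∈ Finset.Ici k, δ m) < ε / 2) :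
    ∃ B : Fin n → Set Ω, (∀ j, MeasurableSet (B j)) ∧ Pairwise (Function.onFun Disjoint B) ∧
      ∀ j, (η / 2 - ε) ^ p ≤ ∫ x in B j, |f j x| ^ p ∂μ := by
  have hp : 0 < p := by linarith
  choose A hA hμA hηA using fun j =>
    exists_rpow_lt_setIntegral_of_lt_omegaP hp1 (by linarith) (hbig j)
  let U : Fin n → Set Ω := fun j => ⋃ k ∈ Finset.Ioi j, A k
  have hU : ∀ j, MeasurableSet (U j) := fun j => Finset.measurableSet_biUnion _ fun k _ => hA k
  have hUint : ∀ j, ∫ x in A j ∩ U j, |f j x| ^ p ∂μ ≤ (ε / 2) ^ p := by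
    intro j
    by_cases hj : (j : ℕ) + 1 < n
    · have hIoi : Finset.Ioi j = Finset.Ici (⟨j + 1, hj⟩ : Fin n) := by
        ext k
        simp only [Finset.mem_Ioi, Finset.mem_Ici, Fin.lt_def, Fin.le_def]
        omega
      refine setIntegral_le_rpow_of_omegaP_le hp1 (f j) (by linarith)
        (hsmall j ⟨j + 1, hj⟩ (Fin.lt_def.2 (by simp))).le ((hA j).inter (hU j)) ?_
      rw [ENNReal.ofReal_sum_of_nonneg fun i _ => (hδpos i).le, ← hIoi]
      exact (measure_mono Set.inter_subset_right).trans
        ((measure_biUnion_finset_le _ _).trans (Finset.sum_le_sum fun k _ => hμA k))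
    · have hIoi : Finset.Ioi j = ∅ := by
        ext k
        simp only [Finset.mem_Ioi, Fin.lt_def, Finset.notMem_empty, iff_false]
        omega
      have : U j = ∅ := by simp only [U, hIoi, Finset.notMem_empty, Set.iUnion_false, Set.iUnion_empty]
      rw [this, Set.inter_empty, setIntegral_empty]
      positivity
  refine ⟨fun j => A j \ U j, fun j => (hA j).diff (hU j), ?_, fun j => ?_⟩
  · have key : ∀ i j : Fin n, i < j → Disjoint (A i \ U i) (A j \ U j) := fun i j hij =>
      Set.disjoint_left.2 fun x hi hj =>
        hi.2 (Set.mem_biUnion (Finset.mem_Ioi.2 hij) hj.1)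
    intro i j hij
    rcases lt_or_gt_of_ne hij with h | h
    · exact key i j h
    · exact (key j i h).symm
  · have hsplit := integral_inter_add_sdiff (s := A j) (hU j)
      (integrable_abs_rpow_Lp hp1 (f j)).integrableOn
    have hsup := Real.add_rpow_le_rpow_add (a := η / 2 - ε) (b := ε / 2) (by linarith)
      (by linarith) hp1
    have hmono := Real.rpow_le_rpow (by linarith) (by linarith : η / 2 - ε + ε / 2 ≤ η) hp.le
    linarith [hUint j, hηA j]

end LpSigns

theorem IsUnconditionalWithFin.one_le {u : ℝ} {n : ℕ} {x : Fin n → E}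
    (h : IsUnconditionalWithFin u x) {j : Fin n} (hj : x j ≠ 0) : 1 ≤ u := by
  have h1 := h (Pi.single j 1) (fun _ => 1) (by simp)
  simp only [one_mul, Pi.single_apply, ite_smul, one_smul, zero_smul, Finset.sum_ite_eq',
    Finset.mem_univ, if_true] at h1
  exact (le_mul_iff_one_le_left (norm_pos_iff.2 hj)).1 h1

/-- (Commutative case of Lemma 3.3.) -/
theorem statement5
    {Ω : Type*} [MeasurableSpace Ω] (μ : Measure Ω) [IsProbabilityMeasure μ]
    (p : ℝ) (hp1 : 1 ≤ p) (hp2 : p < 2)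
    [Fact (1 ≤ ENNReal.ofReal p)]
    (u ε η : ℝ) (hε0 : 0 < ε) (hεη : ε < η / 2)
    (n : ℕ) (hn : 1 ≤ n)
    (f : Fin n → Lp ℝ (ENNReal.ofReal p) μ)
    (hf : ∀ i, ‖f i‖ ≤ 1)
    (huncond : IsUnconditionalWithFin u f)
    (δ : Fin n → ℝ) (hδpos : ∀ i, 0 < δ i) (hδmono : Antitone δ)
    (hbig : ∀ j, η < omegaP μ p (f j : Ω → ℝ) (δ j))
    (hsmall : ∀ j k : Fin n, j < k →
      omegaP μ p (f j : Ω → ℝ) (∑ m ∈ Finset.Ici k, δ m) < ε / 2) :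
    IsLqBasisEquivFin p (u * Real.sqrt 3 * (η / 2 - ε)⁻¹) f := by
  have hp : 0 < p := by linarith
  have hc : 0 < η / 2 - ε := by linarith
  let j₀ : Fin n := ⟨0, hn⟩
  have hη : η < ‖f j₀‖ := by
    obtain ⟨A, -, -, hA⟩ := exists_rpow_lt_setIntegral_of_lt_omegaP hp1 (by linarith) (hbig j₀)
    refine lt_of_lt_of_le ?_ (setIntegral_rpow_le_norm hp1 (f j₀) A)
    rwa [one_div, Real.lt_rpow_inv_iff_of_pos (by linarith)
      (integral_nonneg fun x => Real.rpow_nonneg (abs_nonneg _) _) hp]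
  have hu : 1 ≤ u := huncond.one_le (j := j₀) (norm_pos_iff.1 (by linarith))
  have hu0 : 0 < u := by linarith
  have hη1 : η / 2 - ε ≤ 1 := by linarith [hf j₀]
  have h3 : 1 ≤ Real.sqrt 3 := Real.one_le_sqrt.2 (by norm_num)
  intro a
  set N := (∑ k, |a k| ^ p) ^ (1 / p) with hN
  have hsum0 : 0 ≤ ∑ k, |a k| ^ p :=
    Finset.sum_nonneg fun k _ => Real.rpow_nonneg (abs_nonneg _) _
  have hN0 : 0 ≤ N := Real.rpow_nonneg hsum0 _
  have hNp : N ^ p = ∑ k, |a k| ^ p := by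
    rw [hN, one_div, Real.rpow_inv_rpow hsum0 hp.ne']
  have hnorm : ∀ k, ‖a k • f k‖ ^ p ≤ |a k| ^ p := fun k => by
    refine Real.rpow_le_rpow (norm_nonneg _) ?_ hp.le
    rw [norm_smul, Real.norm_eq_abs]
    exact mul_le_of_le_one_right (abs_nonneg _) (hf k)
  have hupper : ‖∑ k, a k • f k‖ ≤ u * N := by
    obtain ⟨σ, hσ, hle⟩ := exists_signs_norm_sum_rpow_le hp1 hp2.le (fun k => a k • f k)
      Finset.univ
    have hle' : ‖∑ k, σ k • a k • f k‖ ≤ N := by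
      rw [← Real.rpow_le_rpow_iff (norm_nonneg _) hN0 hp, hNp]
      exact hle.trans (Finset.sum_le_sum fun k _ => hnorm k)
    have h := huncond (fun k => σ k * a k) σ hσ
    simp only [← mul_assoc, ← abs_mul_abs_self (σ _), hσ, one_mul] at h
    simp only [mul_smul] at h
    exact h.trans (mul_le_mul_of_nonneg_left hle' hu0.le)
  have hlower : (η / 2 - ε) * N ≤ u * ‖∑ k, a k • f k‖ := by
    obtain ⟨B, hB, hdisj, hBf⟩ := exists_disjoint_rpow_le_setIntegral hp1 hε0 hεη f δ hδpos
      hbig hsmall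
    have hge := sum_signs_norm_rpow_ge hp1 (fun k => a k • f k) B hB hdisj
    have hj : ∀ j, (η / 2 - ε) ^ p * |a j| ^ p ≤ ∫ x in B j, |(a j • f j) x| ^ p ∂μ :=
      fun j => by
        have heq : ∫ x in B j, |(a j • f j) x| ^ p ∂μ =
            ∫ x in B j, |a j| ^ p * |f j x| ^ p ∂μ := by
          refine integral_congr_ae (ae_restrict_of_ae ?_)
          filter_upwards [Lp.coeFn_smul (a j) (f j)] with x hx
          rw [hx, Pi.smul_apply, smul_eq_mul, abs_mul,
            Real.mul_rpow (abs_nonneg _) (abs_nonneg _)]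
        rw [heq, integral_const_mul, mul_comm]
        exact mul_le_mul_of_nonneg_left (hBf j) (Real.rpow_nonneg (abs_nonneg _) _)
    have hle : ∀ σ : Fin n → ℤˣ, ‖∑ k, ((σ k : ℤ) : ℝ) • a k • f k‖ ^ p ≤
        (u * ‖∑ k, a k • f k‖) ^ p := fun σ => by
      refine Real.rpow_le_rpow (norm_nonneg _) ?_ hp.le
      have h := huncond a (fun k => ((σ k : ℤ) : ℝ)) fun k => by
        rcases Int.units_eq_one_or (σ k) with h | h <;> simp [h]
      simpa only [mul_smul] using h
    have hsum := hge.trans (Finset.sum_le_sum fun σ _ => hle σ)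
    rw [Finset.sum_const, nsmul_eq_mul, Finset.card_univ] at hsum
    have hcard : (0 : ℝ) < Fintype.card (Fin n → ℤˣ) := by exact_mod_cast Fintype.card_pos
    have hfin := (Finset.sum_le_sum fun j _ => hj j).trans (le_of_mul_le_mul_left hsum hcard)
    rw [← Finset.mul_sum, ← hNp, ← Real.mul_rpow hc.le hN0] at hfin
    exact (Real.rpow_le_rpow_iff (by positivity) (by positivity) hp).1 hfin
  constructor
  · rw [one_div, mul_inv, mul_inv, inv_inv]
    calc u⁻¹ * (Real.sqrt 3)⁻¹ * (η / 2 - ε) * N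
        = (Real.sqrt 3)⁻¹ * (u⁻¹ * ((η / 2 - ε) * N)) := by ring
      _ ≤ 1 * (u⁻¹ * ((η / 2 - ε) * N)) :=
          mul_le_mul_of_nonneg_right (inv_le_one_of_one_le₀ h3) (by positivity)
      _ ≤ ‖∑ k, a k • f k‖ := by rwa [one_mul, inv_mul_le_iff₀ hu0]
  · refine hupper.trans (mul_le_mul_of_nonneg_right ?_ hN0)
    rw [mul_assoc]
    exact le_mul_of_one_le_right hu0.le
      (one_le_mul_of_one_le_of_one_le h3 ((one_le_inv₀ hc).2 hη1))

end
end

section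
/- (Commutative case of Corollary 3.4.) Let (Ω, μ) be an atomless probability space, 1 ≤ p < 2, and let (f_n) be a bounded unconditional sequence in L^p(μ). Then the following are equivalent: (a) (f_n) has a subsequence which is K-equivalent to the usual ℓ^p basis for some K ≥ 1; (b) the family (|f_n|^p)_{n∈ℕ} is not uniformly integrable. -/
open MeasureTheory Filter
open scoped ENNReal NNReal BigOperators

noncomputable section

variable {E : Type*} [NormedAddCommGroup E] [NormedSpace ℝ E]

/-- The choice of signs that is `1` on `t` and `-1` off `t`. -/
def signOn (t : Finset ℕ) (k : ℕ) : ℝ := if k ∈ t then 1 else -1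

lemma abs_signOn (t : Finset ℕ) (k : ℕ) : |signOn t k| = 1 := by
  unfold signOn; split_ifs <;> simp

lemma signOn_mul_self (t : Finset ℕ) (k : ℕ) : signOn t k * signOn t k = 1 := by
  unfold signOn; split_ifs <;> simp

lemma sum_signOn_insert_self {s t : Finset ℕ} {j : ℕ} (hj : j ∉ s) (c : ℕ → ℝ) :
    ∑ k ∈ insert j s, signOn (insert j t) k * c k = ∑ k ∈ s, signOn t k * c k + c j := by
  rw [Finset.sum_insert hj, add_comm]
  congr 1
  · refine Finset.sum_congr rfl fun k hk => ?_
    have : k ≠ j := by rintro rfl; exact hj hk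
    simp [signOn, this]
  · simp [signOn]

lemma sum_signOn_insert_of_subset {s t : Finset ℕ} {j : ℕ} (hj : j ∉ s) (ht : t ⊆ s)
    (c : ℕ → ℝ) :
    ∑ k ∈ insert j s, signOn t k * c k = ∑ k ∈ s, signOn t k * c k - c j := by
  rw [Finset.sum_insert hj]
  have : j ∉ t := fun h => hj (ht h)
  simp only [signOn, this, if_false]
  ring

/-- The sum of a function of a signed sum over all choices of signs, splitting off one term. -/
lemma sum_powerset_signOn_insert {s : Finset ℕ} {j : ℕ} (hj : j ∉ s) (c : ℕ → ℝ) (φ : ℝ → ℝ) :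
    ∑ t ∈ (insert j s).powerset, φ (∑ k ∈ insert j s, signOn t k * c k) =
      ∑ t ∈ s.powerset,
        (φ (∑ k ∈ s, signOn t k * c k - c j) + φ (∑ k ∈ s, signOn t k * c k + c j)) := by
  rw [Finset.sum_powerset_insert hj, Finset.sum_add_distrib]
  congr 1
  · exact Finset.sum_congr rfl fun t ht => by
      rw [sum_signOn_insert_of_subset hj (Finset.mem_powerset.1 ht)]
  · exact Finset.sum_congr rfl fun t _ => by rw [sum_signOn_insert_self hj]

lemma abs_add_rpow_le {p : ℝ} (hp : 1 ≤ p) (a b : ℝ) :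
    |a + b| ^ p ≤ 2 ^ (p - 1) * (|a| ^ p + |b| ^ p) := by
  refine (Real.rpow_le_rpow (abs_nonneg _) (abs_add_le a b) (by linarith)).trans ?_
  exact_mod_cast NNReal.rpow_add_le_mul_rpow_add_rpow ‖a‖₊ ‖b‖₊ hp

lemma two_mul_abs_rpow_le_s6 {p : ℝ} (hp : 1 ≤ p) (a b : ℝ) :
    2 * |b| ^ p ≤ |a - b| ^ p + |a + b| ^ p := by
  have h := abs_add_rpow_le hp (a + b) (b - a)
  rw [abs_sub_comm b a, show a + b + (b - a) = 2 * b by ring, abs_mul, abs_two,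
    Real.mul_rpow (by norm_num) (abs_nonneg _), Real.rpow_sub_one (by norm_num)] at h
  have h2 : (0 : ℝ) < 2 ^ p := by positivity
  have h3 : (2 : ℝ) ^ p * (2 * |b| ^ p) ≤ 2 ^ p * (|a - b| ^ p + |a + b| ^ p) := by
    linear_combination 2 * h
  exact le_of_mul_le_mul_left h3 h2

lemma sum_signOn_sq (s : Finset ℕ) (c : ℕ → ℝ) :
    ∑ t ∈ s.powerset, (∑ k ∈ s, signOn t k * c k) ^ 2 = 2 ^ s.card * ∑ k ∈ s, c k ^ 2 := by
  induction s using Finset.induction_on with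
  | empty => simp
  | insert j s hj ih =>
    rw [sum_powerset_signOn_insert hj c (fun x => x ^ 2), Finset.sum_insert hj,
      Finset.card_insert_of_notMem hj]
    calc _ = ∑ t ∈ s.powerset, (2 * (∑ k ∈ s, signOn t k * c k) ^ 2 + 2 * c j ^ 2) :=
          Finset.sum_congr rfl fun t _ => by ring
      _ = _ := by
          rw [Finset.sum_add_distrib, ← Finset.mul_sum, ih, Finset.sum_const,
            Finset.card_powerset, nsmul_eq_mul]
          push_cast
          ring

lemma sum_signOn_rpow_le_sq {p : ℝ} (hp : 0 < p) (hp2 : p ≤ 2) (s : Finset ℕ) (c : ℕ → ℝ) :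
    ∑ t ∈ s.powerset, |∑ k ∈ s, signOn t k * c k| ^ p ≤
      2 ^ s.card * (∑ k ∈ s, c k ^ 2) ^ (p / 2) := by
  set S : Finset ℕ → ℝ := fun t => ∑ k ∈ s, signOn t k * c k
  have hN : (0 : ℝ) < 2 ^ s.card := by positivity
  have h := Real.rpow_arith_mean_le_arith_mean_rpow s.powerset (fun _ => ((2 : ℝ) ^ s.card)⁻¹)
    (fun t => |S t| ^ p) (fun _ _ => by positivity)
    (by simp [Finset.card_powerset]) (fun _ _ => by positivity)
    (p := 2 / p) (by rw [le_div_iff₀ hp]; linarith)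
  have e : ∀ t, (|S t| ^ p) ^ (2 / p) = S t ^ 2 := fun t => by
    rw [← Real.rpow_mul (abs_nonneg _), mul_div_cancel₀ _ hp.ne']
    simp
  simp only [e, ← Finset.mul_sum] at h
  rw [sum_signOn_sq, inv_mul_cancel_left₀ hN.ne'] at h
  have hA : 0 ≤ ((2 : ℝ) ^ s.card)⁻¹ * ∑ t ∈ s.powerset, |S t| ^ p := by positivity
  have h' := Real.rpow_le_rpow (by positivity) h (show 0 ≤ p / 2 by positivity)
  rw [← Real.rpow_mul hA, div_mul_div_cancel₀ hp.ne', div_self two_ne_zero, Real.rpow_one,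
    inv_mul_le_iff₀ hN] at h'
  exact h'

lemma sum_rpow_le_sum_rpow {r : ℝ} (hr : 0 < r) (hr1 : r ≤ 1) (s : Finset ℕ) (c : ℕ → ℝ)
    (hc : ∀ k, 0 ≤ c k) : (∑ k ∈ s, c k) ^ r ≤ ∑ k ∈ s, c k ^ r := by
  induction s using Finset.induction_on with
  | empty => simp [hr.ne']
  | insert j s hj ih =>
    rw [Finset.sum_insert hj, Finset.sum_insert hj]
    exact (Real.rpow_add_le_add_rpow (hc j) (Finset.sum_nonneg fun k _ => hc k) hr.le hr1).trans
      (by gcongr)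

lemma sum_signOn_rpow_le {p : ℝ} (hp : 0 < p) (hp2 : p ≤ 2) (s : Finset ℕ) (c : ℕ → ℝ) :
    ∑ t ∈ s.powerset, |∑ k ∈ s, signOn t k * c k| ^ p ≤ 2 ^ s.card * ∑ k ∈ s, |c k| ^ p := by
  refine (sum_signOn_rpow_le_sq hp hp2 s c).trans ?_
  gcongr
  refine (sum_rpow_le_sum_rpow (by positivity) (by linarith) s _ fun k => sq_nonneg _).trans_eq ?_
  refine Finset.sum_congr rfl fun k _ => ?_
  rw [← sq_abs, ← Real.rpow_natCast, ← Real.rpow_mul (abs_nonneg _)]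
  congr 1
  push_cast
  ring

lemma le_sum_signOn_rpow {p : ℝ} (hp : 1 ≤ p) (s : Finset ℕ) (c : ℕ → ℝ) {j : ℕ} (hj : j ∈ s) :
    2 ^ s.card * |c j| ^ p ≤ ∑ t ∈ s.powerset, |∑ k ∈ s, signOn t k * c k| ^ p := by
  obtain ⟨s, hjs, rfl⟩ : ∃ s', j ∉ s' ∧ insert j s' = s :=
    ⟨s.erase j, Finset.notMem_erase j s, Finset.insert_erase hj⟩
  rw [sum_powerset_signOn_insert hjs c (fun x => |x| ^ p), Finset.card_insert_of_notMem hjs]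
  calc _ = ∑ t ∈ s.powerset, 2 * |c j| ^ p := by
        rw [Finset.sum_const, Finset.card_powerset, nsmul_eq_mul]; push_cast; ring
    _ ≤ _ := Finset.sum_le_sum fun t _ => two_mul_abs_rpow_le_s6 hp _ _

section Lp

variable {Ω : Type*} [MeasurableSpace Ω] {μ : Measure Ω} {p : ℝ}

lemma integrable_abs_rpow (hp : 0 < p) (g : Lp ℝ (ENNReal.ofReal p) μ) :
    Integrable (fun x => |g x| ^ p) μ := by
  have h := (Lp.memLp g).integrable_norm_rpow (by simpa using hp) ENNReal.ofReal_ne_top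
  simpa [ENNReal.toReal_ofReal hp.le] using h

lemma norm_rpow_eq_integral (hp : 0 < p) (g : Lp ℝ (ENNReal.ofReal p) μ) :
    ‖g‖ ^ p = ∫ x, |g x| ^ p ∂μ := by
  have h0 : 0 ≤ ∫ x, |g x| ^ p ∂μ := integral_nonneg fun x => by positivity
  rw [Lp.norm_def, (Lp.memLp g).eLpNorm_eq_integral_rpow_norm (by simpa using hp)
    ENNReal.ofReal_ne_top]
  simp only [Real.norm_eq_abs, ENNReal.toReal_ofReal hp.le]
  rw [ENNReal.toReal_ofReal (by positivity), Real.rpow_inv_rpow h0 hp.ne']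

lemma abs_finset_sum_smul_rpow_ae_eq (s : Finset ℕ) (a : ℕ → ℝ)
    (f : ℕ → Lp ℝ (ENNReal.ofReal p) μ) :
    (fun x => |(∑ k ∈ s, a k • f k : Lp ℝ (ENNReal.ofReal p) μ) x| ^ p) =ᵐ[μ]
      fun x => |∑ k ∈ s, a k * f k x| ^ p := by
  have h : ∀ᵐ x ∂μ, ∀ k, (a k • f k : Lp ℝ (ENNReal.ofReal p) μ) x = a k * f k x :=
    ae_all_iff.2 fun k => by
      filter_upwards [Lp.coeFn_smul (a k) (f k)] with x hx
      simp [hx]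
  filter_upwards [Lp.coeFn_finsetSum s fun k => a k • f k, h] with x hx hx'
  rw [hx, Finset.sum_apply]
  simp only [hx']

lemma integrable_abs_sum_rpow (hp : 0 < p) (s : Finset ℕ) (a : ℕ → ℝ)
    (f : ℕ → Lp ℝ (ENNReal.ofReal p) μ) :
    Integrable (fun x => |∑ k ∈ s, a k * f k x| ^ p) μ :=
  (integrable_abs_rpow hp _).congr (abs_finset_sum_smul_rpow_ae_eq s a f)

lemma integrable_sum_signOn_rpow (hp : 0 < p) (s : Finset ℕ) (a : ℕ → ℝ)
    (f : ℕ → Lp ℝ (ENNReal.ofReal p) μ) :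
    Integrable (fun x => ∑ t ∈ s.powerset, |∑ k ∈ s, signOn t k * (a k * f k x)| ^ p) μ := by
  refine integrable_finsetSum _ fun t _ => ?_
  simpa only [mul_assoc] using integrable_abs_sum_rpow hp s (fun k => signOn t k * a k) f

lemma sum_signOn_norm_rpow (hp : 0 < p) (s : Finset ℕ) (a : ℕ → ℝ)
    (f : ℕ → Lp ℝ (ENNReal.ofReal p) μ) :
    ∑ t ∈ s.powerset, ‖∑ k ∈ s, (signOn t k * a k) • f k‖ ^ p =
      ∫ x, ∑ t ∈ s.powerset, |∑ k ∈ s, signOn t k * (a k * f k x)| ^ p ∂μ := by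
  rw [integral_finsetSum]
  · refine Finset.sum_congr rfl fun t _ => ?_
    rw [norm_rpow_eq_integral hp, integral_congr_ae (abs_finset_sum_smul_rpow_ae_eq s _ f)]
    simp only [mul_assoc]
  · intro t _
    simpa only [mul_assoc] using integrable_abs_sum_rpow hp s (fun k => signOn t k * a k) f

/-- `L^p` has type `p` for `p ≤ 2`. -/
lemma sum_signOn_norm_rpow_le (hp : 0 < p) (hp2 : p ≤ 2) (s : Finset ℕ) (a : ℕ → ℝ)
    (f : ℕ → Lp ℝ (ENNReal.ofReal p) μ) :
    ∑ t ∈ s.powerset, ‖∑ k ∈ s, (signOn t k * a k) • f k‖ ^ p ≤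
      2 ^ s.card * ∑ k ∈ s, |a k| ^ p * ‖f k‖ ^ p := by
  have hi : ∀ k ∈ s, Integrable (fun x => |a k| ^ p * |f k x| ^ p) μ :=
    fun k _ => (integrable_abs_rpow hp (f k)).const_mul _
  simp only [norm_rpow_eq_integral hp (f _), ← integral_const_mul]
  rw [sum_signOn_norm_rpow hp, ← integral_finsetSum _ hi, ← integral_const_mul]
  refine integral_mono (integrable_sum_signOn_rpow hp s a f)
    ((integrable_finsetSum _ hi).const_mul _) fun x => ?_
  refine (sum_signOn_rpow_le hp hp2 s fun k => a k * f k x).trans_eq ?_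
  simp only [abs_mul, Real.mul_rpow (abs_nonneg _) (abs_nonneg _)]

lemma le_sum_signOn_norm_rpow (hp : 1 ≤ p) (s : Finset ℕ) (a : ℕ → ℝ)
    (f : ℕ → Lp ℝ (ENNReal.ofReal p) μ) (A : ℕ → Set Ω) (hA : ∀ k, MeasurableSet (A k))
    (hdisj : ∀ k ∈ s, ∀ l ∈ s, k ≠ l → Disjoint (A k) (A l)) :
    2 ^ s.card * ∑ k ∈ s, |a k| ^ p * ∫ x in A k, |f k x| ^ p ∂μ ≤
      ∑ t ∈ s.powerset, ‖∑ k ∈ s, (signOn t k * a k) • f k‖ ^ p := by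
  have hp0 : 0 < p := by linarith
  have hi : ∀ k ∈ s, Integrable (fun x => |a k| ^ p * (A k).indicator (fun x => |f k x| ^ p) x) μ :=
    fun k _ => ((integrable_abs_rpow hp0 (f k)).indicator (hA k)).const_mul _
  simp only [← integral_indicator (hA _), ← integral_const_mul]
  rw [sum_signOn_norm_rpow hp0, ← integral_finsetSum _ hi, ← integral_const_mul]
  refine integral_mono ((integrable_finsetSum _ hi).const_mul _)
    (integrable_sum_signOn_rpow hp0 s a f) fun x => ?_
  by_cases hx : ∃ j ∈ s, x ∈ A j
  · obtain ⟨j, hj, hxj⟩ := hx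
    dsimp only
    rw [Finset.sum_eq_single_of_mem j hj, Set.indicator_of_mem hxj,
      ← Real.mul_rpow (abs_nonneg _) (abs_nonneg _), ← abs_mul]
    · exact le_sum_signOn_rpow hp s (fun k => a k * f k x) hj
    · intro k hk hkj
      rw [Set.indicator_of_notMem, mul_zero]
      exact fun hxk => Set.disjoint_left.1 (hdisj k hk j hj hkj) hxk hxj
  · push Not at hx
    dsimp only
    rw [Finset.sum_eq_zero, mul_zero]
    · positivity
    · intro k hk
      rw [Set.indicator_of_notMem (hx k hk), mul_zero]

/-- An unconditional sequence satisfies an upper `p`-estimate. -/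
lemma IsUnconditionalWith.norm_rpow_le (hp : 0 < p) (hp2 : p ≤ 2)
    {f : ℕ → Lp ℝ (ENNReal.ofReal p) μ} [Fact (1 ≤ ENNReal.ofReal p)] {u M : ℝ} (hu : 0 ≤ u)
    (hf : IsUnconditionalWith u f) (hM : ∀ n, ‖f n‖ ≤ M) (s : Finset ℕ) (a : ℕ → ℝ) :
    ‖∑ k ∈ s, a k • f k‖ ^ p ≤ (u * M) ^ p * ∑ k ∈ s, |a k| ^ p := by
  have hM0 : 0 ≤ M := (norm_nonneg _).trans (hM 0)
  have h1 : ∀ t, ‖∑ k ∈ s, a k • f k‖ ^ p ≤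
      u ^ p * ‖∑ k ∈ s, (signOn t k * a k) • f k‖ ^ p := fun t => by
    rw [← Real.mul_rpow hu (norm_nonneg _)]
    refine Real.rpow_le_rpow (norm_nonneg _) ?_ hp.le
    have := hf s (fun k => signOn t k * a k) (signOn t) fun k _ => abs_signOn t k
    simpa only [← mul_assoc, signOn_mul_self, one_mul] using this
  have h2 : (2 : ℝ) ^ s.card * ‖∑ k ∈ s, a k • f k‖ ^ p ≤
      2 ^ s.card * ((u * M) ^ p * ∑ k ∈ s, |a k| ^ p) := by
    calc _ = ∑ t ∈ s.powerset, ‖∑ k ∈ s, a k • f k‖ ^ p := by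
          rw [Finset.sum_const, Finset.card_powerset, nsmul_eq_mul]; push_cast; rfl
      _ ≤ u ^ p * ∑ t ∈ s.powerset, ‖∑ k ∈ s, (signOn t k * a k) • f k‖ ^ p := by
          rw [Finset.mul_sum]; exact Finset.sum_le_sum fun t _ => h1 t
      _ ≤ u ^ p * (2 ^ s.card * ∑ k ∈ s, |a k| ^ p * M ^ p) := by
          gcongr
          refine (sum_signOn_norm_rpow_le hp hp2 s a f).trans ?_
          gcongr
          exact hM _
      _ = _ := by rw [Real.mul_rpow hu hM0, ← Finset.sum_mul]; ring
  exact le_of_mul_le_mul_left h2 (by positivity)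

/-- An unconditional sequence whose terms keep mass `δ` on pairwise disjoint sets satisfies a
lower `p`-estimate. -/
lemma IsUnconditionalWith.le_norm_rpow (hp : 1 ≤ p)
    {f : ℕ → Lp ℝ (ENNReal.ofReal p) μ} [Fact (1 ≤ ENNReal.ofReal p)] {u δ : ℝ} (hu : 0 ≤ u)
    (hf : IsUnconditionalWith u f) (s : Finset ℕ) (a : ℕ → ℝ)
    (A : ℕ → Set Ω) (hA : ∀ k, MeasurableSet (A k))
    (hdisj : ∀ k ∈ s, ∀ l ∈ s, k ≠ l → Disjoint (A k) (A l))
    (hδ : ∀ k ∈ s, δ ≤ ∫ x in A k, |f k x| ^ p ∂μ) :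
    δ * ∑ k ∈ s, |a k| ^ p ≤ u ^ p * ‖∑ k ∈ s, a k • f k‖ ^ p := by
  have h1 : ∀ t, ‖∑ k ∈ s, (signOn t k * a k) • f k‖ ^ p ≤ u ^ p * ‖∑ k ∈ s, a k • f k‖ ^ p :=
    fun t => by
      rw [← Real.mul_rpow hu (norm_nonneg _)]
      exact Real.rpow_le_rpow (norm_nonneg _) (hf s a (signOn t) fun k _ => abs_signOn t k)
        (by linarith)
  have h2 : (2 : ℝ) ^ s.card * (δ * ∑ k ∈ s, |a k| ^ p) ≤
      2 ^ s.card * (u ^ p * ‖∑ k ∈ s, a k • f k‖ ^ p) := by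
    calc _ ≤ 2 ^ s.card * ∑ k ∈ s, |a k| ^ p * ∫ x in A k, |f k x| ^ p ∂μ := by
          rw [Finset.mul_sum]
          refine mul_le_mul_of_nonneg_left (Finset.sum_le_sum fun k hk => ?_) (by positivity)
          rw [mul_comm]
          exact mul_le_mul_of_nonneg_left (hδ k hk) (by positivity)
      _ ≤ _ := le_sum_signOn_norm_rpow hp s a f A hA hdisj
      _ ≤ ∑ t ∈ s.powerset, u ^ p * ‖∑ k ∈ s, a k • f k‖ ^ p := Finset.sum_le_sum fun t _ => h1 t
      _ = _ := by rw [Finset.sum_const, Finset.card_powerset, nsmul_eq_mul]; push_cast; rfl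
  exact le_of_mul_le_mul_left h2 (by positivity)

lemma IsUnconditionalWith.comp_strictMono {E : Type*} [NormedAddCommGroup E] [NormedSpace ℝ E]
    {f : ℕ → E} {u : ℝ} (hf : IsUnconditionalWith u f) {k : ℕ → ℕ} (hk : StrictMono k) :
    IsUnconditionalWith u fun m => f (k m) := by
  intro s c ε hε
  have hinv : ∀ m, Function.invFun k (k m) = m := Function.leftInverse_invFun hk.injective
  have h := hf (s.map ⟨k, hk.injective⟩) (c ∘ Function.invFun k) (ε ∘ Function.invFun k)
    (by simpa [hinv] using hε)
  simpa [Finset.sum_map, hinv] using h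

/-- A sequence whose `p`-th powers are not uniformly integrable has a subsequence, and a sequence
of sets, such that each term of the subsequence keeps a fixed mass on its set, while later sets
carry little mass of earlier terms. -/
lemma exists_strictMono_of_not_unifIntPow (hp : 0 < p) (f : ℕ → Lp ℝ (ENNReal.ofReal p) μ)
    (hf : ¬ UnifIntPow μ p fun n => (f n : Ω → ℝ)) :
    ∃ ε : ℝ, 0 < ε ∧ ∃ (k : ℕ → ℕ) (B : ℕ → Set Ω), StrictMono k ∧ (∀ i, MeasurableSet (B i)) ∧
      (∀ i, ε ≤ ∫ x in B i, |f (k i) x| ^ p ∂μ) ∧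
      ∀ i j, i < j → ∫ x in B j, |f (k i) x| ^ p ∂μ ≤ ε / 4 * (1 / 2) ^ j := by
  unfold UnifIntPow at hf
  push Not at hf
  obtain ⟨ε, hε, hf⟩ := hf
  choose n A hA hμA hint using fun m : ℕ => hf (1 / ((m : ℝ) + 1)) (by positivity)
  have hlim : Tendsto (⇑μ ∘ A) atTop (nhds 0) := by
    refine tendsto_of_tendsto_of_tendsto_of_le_of_le tendsto_const_nhds ?_
      (fun _ => zero_le) hμA
    simpa using ENNReal.tendsto_ofReal tendsto_one_div_add_atTop_nhds_zero_nat
  have hstep : ∀ j N : ℕ, ∃ m, ∀ i ≤ N, ∫ x in A m, |f i x| ^ p ∂μ ≤ ε / 4 * (1 / 2) ^ j := by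
    intro j N
    have h : ∀ i ∈ Finset.range (N + 1), ∀ᶠ m in atTop,
        ∫ x in A m, |f i x| ^ p ∂μ ≤ ε / 4 * (1 / 2) ^ j := fun i _ =>
      ((integrable_abs_rpow hp (f i)).tendsto_setIntegral_nhds_zero hlim).eventually_le_const
        (by positivity)
    obtain ⟨m, hm⟩ := ((Finset.eventually_all _).2 h).exists
    exact ⟨m, fun i hi => hm i (by simpa [Nat.lt_succ_iff] using hi)⟩
  choose F hF using hstep
  let m : ℕ → ℕ := fun j => Nat.rec 0 (fun j mj => F (j + 1) (n mj)) j
  have hm : ∀ j, ∀ i ≤ n (m j), ∫ x in A (m (j + 1)), |f i x| ^ p ∂μ ≤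
      ε / 4 * (1 / 2) ^ (j + 1) := fun j => hF (j + 1) (n (m j))
  have hmono : StrictMono fun j => n (m j) := by
    refine strictMono_nat_of_lt_succ fun j => ?_
    by_contra! hle
    have h1 := hm j _ hle
    have h2 := hint (m (j + 1))
    have h3 : ((1 : ℝ) / 2) ^ (j + 1) ≤ 1 := pow_le_one₀ (by norm_num) (by norm_num)
    nlinarith
  refine ⟨ε, hε, fun j => n (m j), fun j => A (m j), hmono, fun j => hA _,
    fun j => (hint _).le, fun i j hij => ?_⟩
  obtain ⟨j, rfl⟩ := Nat.exists_eq_succ_of_ne_zero (Nat.ne_zero_of_lt hij)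
  exact hm j _ (hmono.monotone (Nat.lt_succ_iff.1 hij))

/-- Removing from each set the later ones makes finitely many sets disjoint without losing more
than half of the mass. -/
lemma half_le_setIntegral_diff {g : ℕ → Ω → ℝ} (hg : ∀ i, Integrable (g i) μ)
    (hg0 : ∀ i x, 0 ≤ g i x) {ε : ℝ} (hε : 0 ≤ ε) {B : ℕ → Set Ω} (hB : ∀ i, MeasurableSet (B i))
    (hlow : ∀ i, ε ≤ ∫ x in B i, g i x ∂μ)
    (hsmall : ∀ i j, i < j → ∫ x in B j, g i x ∂μ ≤ ε / 4 * (1 / 2) ^ j) (s : Finset ℕ) (i : ℕ) :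
    ε / 2 ≤ ∫ x in B i \ ⋃ j ∈ s.filter (i < ·), B j, g i x ∂μ := by
  have hmeas : MeasurableSet (B i \ ⋃ j ∈ s.filter (i < ·), B j) :=
    (hB i).diff (Finset.measurableSet_biUnion _ fun j _ => hB j)
  have hsum : ∑ j ∈ s.filter (i < ·), ∫ x in B j, g i x ∂μ ≤ ε / 2 := by
    calc _ ≤ ∑ j ∈ s.filter (i < ·), ε / 4 * (1 / 2) ^ j :=
          Finset.sum_le_sum fun j hj => hsmall i j (Finset.mem_filter.1 hj).2
      _ = ε / 4 * ∑ j ∈ s.filter (i < ·), (1 / 2 : ℝ) ^ j := by rw [Finset.mul_sum]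
      _ ≤ ε / 4 * 2 := by
          gcongr
          exact sum_le_hasSum _ (fun _ _ => by positivity) hasSum_geometric_two
      _ = ε / 2 := by ring
  have hdom : ∫ x in B i, g i x ∂μ ≤ ∫ x in B i \ ⋃ j ∈ s.filter (i < ·), B j, g i x ∂μ +
      ∑ j ∈ s.filter (i < ·), ∫ x in B j, g i x ∂μ := by
    simp only [← integral_indicator (hB _), ← integral_indicator hmeas]
    have hi : ∀ j ∈ s.filter (i < ·), Integrable ((B j).indicator (g i)) μ :=
      fun j _ => (hg i).indicator (hB j)
    have hi' : Integrable ((B i \ ⋃ j ∈ s.filter (i < ·), B j).indicator (g i)) μ :=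
      (hg i).indicator hmeas
    rw [← integral_finsetSum _ hi, ← integral_add hi' (integrable_finsetSum _ hi)]
    refine integral_mono ((hg i).indicator (hB i)) (hi'.add (integrable_finsetSum _ hi))
      fun x => ?_
    have hnn : ∀ j ∈ s.filter (i < ·), 0 ≤ (B j).indicator (g i) x :=
      fun j _ => Set.indicator_nonneg (fun y _ => hg0 i y) x
    by_cases hx : x ∈ ⋃ j ∈ s.filter (i < ·), B j
    · obtain ⟨j, hj, hxj⟩ := Set.mem_iUnion₂.1 hx
      calc (B i).indicator (g i) x ≤ g i x := Set.indicator_le_self' (fun y _ => hg0 i y) x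
        _ = (B j).indicator (g i) x := (Set.indicator_of_mem hxj _).symm
        _ ≤ ∑ j ∈ s.filter (i < ·), (B j).indicator (g i) x := Finset.single_le_sum hnn hj
        _ ≤ _ := le_add_of_nonneg_left (Set.indicator_nonneg (fun y _ => hg0 i y) x)
    · refine le_add_of_le_of_nonneg (le_of_eq ?_) (Finset.sum_nonneg hnn)
      by_cases hxi : x ∈ B i
      · rw [Set.indicator_of_mem hxi, Set.indicator_of_mem (Set.mem_sdiff_of_mem hxi hx)]
      · rw [Set.indicator_of_notMem hxi, Set.indicator_of_notMem fun h => hxi h.1]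
  linarith [hlow i]

lemma disjoint_diff_biUnion_filter_lt {X : Type*} (B : ℕ → Set X) (s : Finset ℕ) :
    ∀ k ∈ s, ∀ l ∈ s, k ≠ l → Disjoint (B k \ ⋃ j ∈ s.filter (k < ·), B j)
      (B l \ ⋃ j ∈ s.filter (l < ·), B j) := by
  intro k hk l hl hkl
  refine Set.disjoint_left.2 fun x hxk hxl => ?_
  rcases lt_or_gt_of_ne hkl with h | h
  · exact hxk.2 (Set.mem_iUnion₂.2 ⟨l, Finset.mem_filter.2 ⟨hl, h⟩, hxl.1⟩)
  · exact hxl.2 (Set.mem_iUnion₂.2 ⟨k, Finset.mem_filter.2 ⟨hk, h⟩, hxk.1⟩)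

lemma exists_isLqBasisEquiv_of_not_unifIntPow (hp : 1 ≤ p) (hp2 : p ≤ 2)
    [Fact (1 ≤ ENNReal.ofReal p)] {f : ℕ → Lp ℝ (ENNReal.ofReal p) μ} {M : ℝ}
    (hM : ∀ n, ‖f n‖ ≤ M) (hunc : IsUnconditional f)
    (hf : ¬ UnifIntPow μ p fun n => (f n : Ω → ℝ)) :
    ∃ k : ℕ → ℕ, StrictMono k ∧ ∃ K : ℝ, 1 ≤ K ∧ IsLqBasisEquiv p K fun m => f (k m) := by
  have hp0 : 0 < p := by linarith
  obtain ⟨u, hu, hunc⟩ := hunc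
  have hu0 : 0 < u := by linarith
  have hM0 : 0 ≤ M := (norm_nonneg _).trans (hM 0)
  obtain ⟨ε, hε, k, B, hk, hB, hlow, hsmall⟩ := exists_strictMono_of_not_unifIntPow hp0 f hf
  set δ : ℝ := (ε / 2) ^ (1 / p) with hδ
  have hδ0 : 0 < δ := by positivity
  have hδp : δ ^ p = ε / 2 := by
    rw [hδ, one_div, Real.rpow_inv_rpow (by positivity) hp0.ne']
  refine ⟨k, hk, max 1 (max (u * M) (u / δ)), le_max_left _ _, fun s a => ?_⟩
  set K := max 1 (max (u * M) (u / δ))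
  have hK0 : 0 < K := lt_of_lt_of_le one_pos (le_max_left _ _)
  have hK1 : u * M ≤ K := (le_max_left _ _).trans (le_max_right _ _)
  have hK2 : u / δ ≤ K := (le_max_right _ _).trans (le_max_right _ _)
  have hunc' := hunc.comp_strictMono hk
  set S : ℝ := ∑ k ∈ s, |a k| ^ p
  have hS0 : 0 ≤ S := Finset.sum_nonneg fun k _ => by positivity
  have hSp : (S ^ (1 / p)) ^ p = S := by rw [one_div, Real.rpow_inv_rpow hS0 hp0.ne']
  have hupper := hunc'.norm_rpow_le hp0 hp2 hu0.le (fun m => hM (k m)) s a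
  have hlower := hunc'.le_norm_rpow hp hu0.le s a
    (fun i => B i \ ⋃ j ∈ s.filter (i < ·), B j)
    (fun i => (hB i).diff (Finset.measurableSet_biUnion _ fun j _ => hB j))
    (disjoint_diff_biUnion_filter_lt B s)
    (fun i _ => half_le_setIntegral_diff (g := fun i x => |f (k i) x| ^ p)
      (fun i => integrable_abs_rpow hp0 (f (k i))) (fun i x => by positivity) hε.le hB hlow
      hsmall s i)
  constructor
  · have h : δ * S ^ (1 / p) ≤ u * ‖∑ m ∈ s, a m • f (k m)‖ := by
      rw [← Real.rpow_le_rpow_iff (by positivity) (by positivity) hp0,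
        Real.mul_rpow hδ0.le (by positivity), Real.mul_rpow hu0.le (norm_nonneg _), hSp, hδp]
      exact hlower
    rw [one_div_mul_eq_div, div_le_iff₀ hK0]
    rw [div_le_iff₀ hδ0] at hK2
    have h' : δ * S ^ (1 / p) ≤ δ * (‖∑ m ∈ s, a m • f (k m)‖ * K) :=
      h.trans ((mul_le_mul_of_nonneg_right hK2 (norm_nonneg _)).trans_eq (by ring))
    exact le_of_mul_le_mul_left h' hδ0
  · refine le_trans ?_ (mul_le_mul_of_nonneg_right hK1 (by positivity))
    rw [← Real.rpow_le_rpow_iff (by positivity) (by positivity) hp0,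
      Real.mul_rpow (by positivity) (by positivity), hSp]
    exact hupper

lemma sum_signOn_rpow_le_of_split (hp : 1 ≤ p) (hp2 : p ≤ 2) (s : Finset ℕ) (c : ℕ → ℝ)
    (b : ℕ → Prop) [DecidablePred b] {T : ℝ} (hT : 0 ≤ T) (hb : ∀ k, ¬ b k → |c k| ^ p ≤ T) :
    ∑ t ∈ s.powerset, |∑ k ∈ s, signOn t k * c k| ^ p ≤
      2 ^ (p - 1) * (2 ^ s.card *
        (T * (s.card : ℝ) ^ (p / 2) + ∑ k ∈ s, if b k then |c k| ^ p else 0)) := by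
  have hp0 : 0 < p := by linarith
  set g : ℕ → ℝ := fun k => if b k then 0 else c k with hg
  set h : ℕ → ℝ := fun k => if b k then c k else 0 with hh
  have hgh : ∀ k, c k = g k + h k := fun k => by by_cases hk : b k <;> simp [hg, hh, hk]
  have hg2 : ∀ k, g k ^ 2 ≤ T ^ (2 / p) := fun k => by
    by_cases hk : b k
    · have : 0 ≤ T ^ (2 / p) := by positivity
      simpa [hg, hk] using this
    · simp only [hg, hk, if_false]
      have := Real.rpow_le_rpow (by positivity) (hb k hk) (show 0 ≤ 2 / p by positivity)
      rwa [← Real.rpow_mul (abs_nonneg _), mul_div_cancel₀ _ hp0.ne', Real.rpow_two, sq_abs]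
        at this
  have hgs : (∑ k ∈ s, g k ^ 2) ^ (p / 2) ≤ T * (s.card : ℝ) ^ (p / 2) := by
    calc _ ≤ ((s.card : ℝ) * T ^ (2 / p)) ^ (p / 2) := by
          refine Real.rpow_le_rpow (Finset.sum_nonneg fun k _ => sq_nonneg _) ?_ (by positivity)
          exact (Finset.sum_le_sum fun k _ => hg2 k).trans_eq (by rw [Finset.sum_const, nsmul_eq_mul])
      _ = _ := by
          rw [Real.mul_rpow (Nat.cast_nonneg _) (by positivity), ← Real.rpow_mul hT,
            div_mul_div_cancel₀ hp0.ne', div_self two_ne_zero, Real.rpow_one, mul_comm]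
  have hhs : ∑ k ∈ s, |h k| ^ p = ∑ k ∈ s, if b k then |c k| ^ p else 0 :=
    Finset.sum_congr rfl fun k _ => by by_cases hk : b k <;> simp [hh, hk, hp0.ne']
  calc _ ≤ ∑ t ∈ s.powerset, 2 ^ (p - 1) *
        (|∑ k ∈ s, signOn t k * g k| ^ p + |∑ k ∈ s, signOn t k * h k| ^ p) := by
        refine Finset.sum_le_sum fun t _ => ?_
        have : ∑ k ∈ s, signOn t k * c k =
            ∑ k ∈ s, signOn t k * g k + ∑ k ∈ s, signOn t k * h k := by
          rw [← Finset.sum_add_distrib]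
          exact Finset.sum_congr rfl fun k _ => by rw [hgh k, mul_add]
        rw [this]
        exact abs_add_rpow_le hp _ _
    _ ≤ 2 ^ (p - 1) * (2 ^ s.card * (T * (s.card : ℝ) ^ (p / 2)) +
        2 ^ s.card * ∑ k ∈ s, |h k| ^ p) := by
        rw [← Finset.mul_sum, Finset.sum_add_distrib]
        gcongr
        · exact (sum_signOn_rpow_le_sq hp0 hp2 s g).trans (by gcongr)
        · exact sum_signOn_rpow_le hp0 hp2 s h
    _ = _ := by rw [hhs]; ring

/-- For `p < 2`, signed sums of a uniformly integrable sequence grow slower than `N ^ (1 / p)` on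
average. -/
lemma UnifIntPow.exists_sum_signOn_norm_rpow_le [IsProbabilityMeasure μ] (hp : 1 ≤ p)
    (hp2 : p ≤ 2) [Fact (1 ≤ ENNReal.ofReal p)]
    {f : ℕ → Lp ℝ (ENNReal.ofReal p) μ} {M : ℝ} (hM : ∀ n, ‖f n‖ ≤ M)
    (hf : UnifIntPow μ p fun n => (f n : Ω → ℝ)) {η : ℝ} (hη : 0 < η) :
    ∃ C : ℝ, ∀ s : Finset ℕ, ∑ t ∈ s.powerset, ‖∑ k ∈ s, signOn t k • f k‖ ^ p ≤
      2 ^ s.card * (C * (s.card : ℝ) ^ (p / 2) + η * s.card) := by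
  classical
  have hp0 : 0 < p := by linarith
  have hM0 : 0 ≤ M := (norm_nonneg _).trans (hM 0)
  have hD : (0 : ℝ) < 2 ^ (p - 1) := by positivity
  obtain ⟨δ, hδ, hf⟩ := hf (η / 2 ^ (p - 1)) (by positivity)
  set T : ℝ := (M ^ p + 1) / δ with hT
  have hT0 : 0 < T := by positivity
  set A : ℕ → Set Ω := fun k => {x | T ≤ |f k x| ^ p} with hA
  have hAm : ∀ k, MeasurableSet (A k) := fun k =>
    measurableSet_le measurable_const
      ((Lp.stronglyMeasurable (f k)).measurable.norm.pow_const p)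
  have hAμ : ∀ k, μ (A k) ≤ ENNReal.ofReal δ := fun k => by
    have h1 := mul_meas_ge_le_integral_of_nonneg (ae_of_all _ fun x => by positivity)
      (integrable_abs_rpow hp0 (f k)) T
    rw [← norm_rpow_eq_integral hp0] at h1
    have h2 : ‖f k‖ ^ p ≤ M ^ p := Real.rpow_le_rpow (norm_nonneg _) (hM k) hp0.le
    have h3 : μ.real (A k) ≤ δ := by
      refine le_of_mul_le_mul_left (?_ : T * _ ≤ T * δ) hT0
      rw [hT, div_mul_cancel₀ _ hδ.ne', ← hT]
      linarith
    rw [← ofReal_measureReal]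
    exact ENNReal.ofReal_le_ofReal h3
  have hAi : ∀ k, ∫ x in A k, |f k x| ^ p ∂μ ≤ η / 2 ^ (p - 1) :=
    fun k => hf k (A k) (hAm k) (hAμ k)
  refine ⟨2 ^ (p - 1) * T, fun s => ?_⟩
  have hi : ∀ k ∈ s, Integrable ((A k).indicator fun x => |f k x| ^ p) μ :=
    fun k _ => (integrable_abs_rpow hp0 (f k)).indicator (hAm k)
  have hi' := ((integrable_const (T * (s.card : ℝ) ^ (p / 2))).add
    (integrable_finsetSum _ hi)).const_mul (2 ^ s.card : ℝ) |>.const_mul ((2 : ℝ) ^ (p - 1))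
  have key := sum_signOn_norm_rpow hp0 s (fun _ => 1) f
  have hint := integrable_sum_signOn_rpow hp0 s (fun _ => 1) f
  simp only [mul_one, one_mul] at key hint
  rw [key]
  refine (integral_mono hint hi' fun x => ?_).trans ?_
  · refine (sum_signOn_rpow_le_of_split hp hp2 s (fun k => f k x) (fun k => x ∈ A k) hT0.le
      fun k hk => (not_le.1 hk).le).trans_eq ?_
    simp [Set.indicator_apply]
  · rw [integral_const_mul, integral_const_mul]
    simp only [Pi.add_apply]
    rw [integral_add (integrable_const _) (integrable_finsetSum _ hi), integral_finsetSum _ hi]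
    simp only [integral_indicator (hAm _), integral_const, probReal_univ, one_smul]
    calc _ ≤ (2 : ℝ) ^ (p - 1) * (2 ^ s.card * (T * (s.card : ℝ) ^ (p / 2) +
          ∑ _k ∈ s, η / 2 ^ (p - 1))) := by
          gcongr
          exact hAi _
      _ = _ := by
          rw [Finset.sum_const, nsmul_eq_mul]
          field_simp

lemma UnifIntPow.comp {f : ℕ → Ω → ℝ} (hf : UnifIntPow μ p f) (k : ℕ → ℕ) :
    UnifIntPow μ p fun m => f (k m) := fun ε hε => by
  obtain ⟨δ, hδ, h⟩ := hf ε hε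
  exact ⟨δ, hδ, fun n => h (k n)⟩

lemma not_isLqBasisEquiv_of_unifIntPow [IsProbabilityMeasure μ] (hp : 1 ≤ p) (hp2 : p < 2)
    [Fact (1 ≤ ENNReal.ofReal p)] {f : ℕ → Lp ℝ (ENNReal.ofReal p) μ} {M : ℝ}
    (hM : ∀ n, ‖f n‖ ≤ M) (hf : UnifIntPow μ p fun n => (f n : Ω → ℝ)) {K : ℝ} (hK : 0 < K) :
    ¬ IsLqBasisEquiv p K f := by
  intro hequiv
  have hp0 : 0 < p := by linarith
  set κ : ℝ := (1 / K) ^ p with hκ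
  have hκ0 : 0 < κ := by positivity
  obtain ⟨C, hC⟩ := hf.exists_sum_signOn_norm_rpow_le hp hp2.le hM (half_pos hκ0)
  have hbound : ∀ N : ℕ, κ / 2 * (N : ℝ) ≤ C * (N : ℝ) ^ (p / 2) := fun N => by
    have hlow : ∀ t, κ * N ≤ ‖∑ k ∈ Finset.range N, signOn t k • f k‖ ^ p := fun t => by
      have h := (hequiv (Finset.range N) (signOn t)).1
      simp only [abs_signOn, Real.one_rpow, Finset.sum_const, Finset.card_range, nsmul_eq_mul,
        mul_one] at h
      have h' := Real.rpow_le_rpow (by positivity) h hp0.le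
      rwa [Real.mul_rpow (by positivity) (by positivity), ← Real.rpow_mul (by positivity),
        one_div_mul_cancel hp0.ne', Real.rpow_one] at h'
    have h := (Finset.sum_le_sum fun t (_ : t ∈ (Finset.range N).powerset) => hlow t).trans
      (hC (Finset.range N))
    rw [Finset.sum_const, Finset.card_powerset, nsmul_eq_mul, Finset.card_range] at h
    push_cast at h
    have h' := le_of_mul_le_mul_left h (by positivity)
    linarith
  have hlim : Tendsto (fun N : ℕ => (N : ℝ) ^ (1 - p / 2)) atTop atTop :=
    (tendsto_rpow_atTop (by linarith)).comp tendsto_natCast_atTop_atTop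
  obtain ⟨N, hN, hN1⟩ :=
    ((hlim.eventually_gt_atTop (C / (κ / 2))).and (eventually_ge_atTop 1)).exists
  have hN0 : (0 : ℝ) < N := by exact_mod_cast hN1
  have h := hbound N
  rw [Real.rpow_sub hN0, Real.rpow_one, div_lt_div_iff₀ (by positivity) (by positivity)] at hN
  linarith

end Lp

/-- (Commutative case of Corollary 3.4.) -/
theorem statement6
    {Ω : Type*} [MeasurableSpace Ω] (μ : Measure Ω) [IsProbabilityMeasure μ]
    (hμ : Atomless μ)
    (p : ℝ) (hp1 : 1 ≤ p) (hp2 : p < 2)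
    [Fact (1 ≤ ENNReal.ofReal p)]
    (f : ℕ → Lp ℝ (ENNReal.ofReal p) μ)
    (M : ℝ) (hM : ∀ n, ‖f n‖ ≤ M)
    (huncond : IsUnconditional f) :
    (∃ k : ℕ → ℕ, StrictMono k ∧ ∃ K : ℝ, 1 ≤ K ∧ IsLqBasisEquiv p K fun m => f (k m)) ↔
      ¬ UnifIntPow μ p fun n => (f n : Ω → ℝ) := by
  constructor
  · rintro ⟨k, -, K, hK, hequiv⟩ hf
    exact not_isLqBasisEquiv_of_unifIntPow hp1 hp2 (fun m => hM (k m)) (hf.comp k)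
      (by linarith) hequiv
  · exact exists_isLqBasisEquiv_of_not_unifIntPow hp1 hp2.le hM huncond

end
end

section
/- (Corollary 3.9.) Let X be a uniformly convex Banach space and let λ ≥ 1, ε > 0, and k ∈ ℕ be given. Then there is n ≥ k such that for every λ-basic sequence (x_1, …, x_n) of nonzero vectors in X, there exist indices 1 ≤ j_1 < j_2 < ⋯ < j_k ≤ n such that (x_{j_1}, …, x_{j_k}) is suppression (1+ε)-unconditional. -/
open MeasureTheory Filter
open scoped ENNReal NNReal BigOperators

noncomputable section

variable {E : Type*} [NormedAddCommGroup E] [NormedSpace ℝ E]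

/-- A finite sequence is `lam`-basic. -/
def IsBasicWithFin (lam : ℝ) {n : ℕ} (x : Fin n → E) : Prop :=
  ∀ (c : Fin n → ℝ) (m : ℕ), m ≤ n →
    ‖∑ i ∈ Finset.univ.filter (fun i : Fin n => (i : ℕ) < m), c i • x i‖ ≤
      lam * ‖∑ i, c i • x i‖

/-- A finite sequence is suppression `β`-unconditional. -/
def IsSuppUnconditionalFin (β : ℝ) {k : ℕ} (y : Fin k → E) : Prop :=
  ∀ (c : Fin k → ℝ) (F : Finset (Fin k)),
    ‖∑ j ∈ F, c j • y j‖ ≤ β * ‖∑ j, c j • y j‖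

/-- Induction step of Ramsey's theorem: if it holds for `r`-tuples, then every coloring of
`(r + 1)`-tuples has arbitrarily large sets on which the color depends only on the first entry. -/
theorem exists_endHomogeneous {κ : Type*} [Finite κ] {r : ℕ}
    (ih : ∀ m : ℕ, ∃ n : ℕ, ∀ (f : (Fin r → ℕ) → κ) (S : Finset ℕ), n ≤ S.card →
      ∃ T ⊆ S, T.card = m ∧ ∃ c, ∀ a : Fin r → ℕ, StrictMono a → (∀ i, a i ∈ T) → f a = c)
    (m : ℕ) :
    ∃ n : ℕ, ∀ (f : (Fin (r + 1) → ℕ) → κ) (S : Finset ℕ), n ≤ S.card →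
      ∃ T ⊆ S, T.card = m ∧ ∃ g : ℕ → κ, ∀ a : Fin (r + 1) → ℕ, StrictMono a →
        (∀ i, a i ∈ T) → f a = g (a 0) := by
  induction m with
  | zero =>
    refine ⟨0, fun f S _ => ⟨∅, Finset.empty_subset S, rfl, fun _ => f 0, fun a _ h => ?_⟩⟩
    exact absurd (h 0) (Finset.notMem_empty _)
  | succ m ihm =>
    obtain ⟨N, hN⟩ := ihm
    obtain ⟨n, hn⟩ := ih N
    refine ⟨n + 1, fun f S hS => ?_⟩
    have hne : S.Nonempty := Finset.card_pos.1 (by omega)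
    set s := S.min' hne with hs
    have hsS : s ∈ S := S.min'_mem hne
    obtain ⟨U, hUS, hU, c, hc⟩ := hn (fun b => f (Fin.cons s b)) (S.erase s)
      (by rw [Finset.card_erase_of_mem hsS]; omega)
    obtain ⟨T, hTU, hT, g, hg⟩ := hN f U hU.ge
    have hlt : ∀ t ∈ T, s < t := fun t ht => S.min'_lt_of_mem_erase_min' hne (hUS (hTU ht))
    have hsT : s ∉ T := fun h => lt_irrefl _ (hlt s h)
    refine ⟨insert s T, ?_, by rw [Finset.card_insert_of_notMem hsT, hT],
      Function.update g s c, fun a ha haT => ?_⟩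
    · exact Finset.insert_subset hsS ((hTU.trans hUS).trans (Finset.erase_subset _ _))
    · have hmem : ∀ i, s < a i → a i ∈ T := fun i hi =>
        (Finset.mem_insert.1 (haT i)).resolve_left hi.ne'
      by_cases h0 : a 0 = s
      · have key := hc (Fin.tail a) (fun i j hij => ha (Fin.succ_lt_succ_iff.2 hij))
          (fun i => hTU (hmem _ (h0 ▸ ha (Fin.succ_pos i))))
        rw [← h0, Fin.cons_self_tail] at key
        rw [key, h0, Function.update_self]
      · have h0T : a 0 ∈ T := (Finset.mem_insert.1 (haT 0)).resolve_left h0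
        rw [Function.update_of_ne h0]
        exact hg a ha fun i => hmem i ((hlt _ h0T).trans_le (ha.monotone (Fin.zero_le i)))

/-- Finite Ramsey theorem for increasing `r`-tuples of natural numbers. -/
theorem exists_homogeneous {κ : Type*} [Finite κ] (r m : ℕ) :
    ∃ n : ℕ, ∀ (f : (Fin r → ℕ) → κ) (S : Finset ℕ), n ≤ S.card →
      ∃ T ⊆ S, T.card = m ∧ ∃ c, ∀ a : Fin r → ℕ, StrictMono a → (∀ i, a i ∈ T) → f a = c := by
  classical
  induction r generalizing m with
  | zero =>
    refine ⟨m, fun f S hS => ?_⟩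
    obtain ⟨T, hTS, hT⟩ := Finset.exists_subset_card_eq hS
    exact ⟨T, hTS, hT, f 0, fun a _ _ => congrArg f (Subsingleton.elim _ _)⟩
  | succ r ih =>
    have := Fintype.ofFinite κ
    obtain ⟨n, hn⟩ := exists_endHomogeneous ih (Fintype.card κ * m)
    refine ⟨n, fun f S hS => ?_⟩
    obtain ⟨U, hUS, hU, g, hg⟩ := hn f S hS
    obtain ⟨c, -, hc⟩ := Finset.exists_le_card_fiber_of_mul_le_card_of_maps_to
      (s := U) (t := Finset.univ) (f := g) (n := m) (fun _ _ => Finset.mem_univ _)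
      ⟨f 0, Finset.mem_univ _⟩ (by rw [hU, Finset.card_univ])
    obtain ⟨T, hTU, hT⟩ := Finset.exists_subset_card_eq hc
    refine ⟨T, (hTU.trans (Finset.filter_subset _ _)).trans hUS, hT, c, fun a ha haT => ?_⟩
    rw [hg a ha fun i => (Finset.mem_filter.1 (hTU (haT i))).1]
    exact (Finset.mem_filter.1 (hTU (haT 0))).2

/-- A sequence (possibly with zero terms) is `lam`-basic in terms of spans of initial and final
segments. -/
def IsSpanBasic {X : Type*} [NormedAddCommGroup X] [NormedSpace ℝ X] (lam : ℝ) (y : ℕ → X) :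
    Prop :=
  ∀ p : ℕ, ∀ u ∈ Submodule.span ℝ (y '' Set.Iio p), ∀ v ∈ Submodule.span ℝ (y '' Set.Ici p),
    ‖u‖ ≤ lam * ‖u + v‖

section

variable {X : Type*} [NormedAddCommGroup X] [NormedSpace ℝ X] {lam : ℝ} {y : ℕ → X}

theorem IsSpanBasic.comp_strictMono (hy : IsSpanBasic lam y) {e : ℕ → ℕ} (he : StrictMono e) :
    IsSpanBasic lam (y ∘ e) := by
  intro p u hu v hv
  refine hy (e p) u (Submodule.span_mono ?_ hu) v (Submodule.span_mono ?_ hv)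
  · rintro _ ⟨i, hi, rfl⟩
    exact ⟨e i, he hi, rfl⟩
  · rintro _ ⟨i, hi, rfl⟩
    exact ⟨e i, he.monotone hi, rfl⟩

/-- The normalization of a finite sequence, extended by zero. -/
def normalizedExtension {n : ℕ} (x : Fin n → X) (i : ℕ) : X :=
  if h : i < n then ‖x ⟨i, h⟩‖⁻¹ • x ⟨i, h⟩ else 0

theorem normalizedExtension_val {n : ℕ} (x : Fin n → X) (i : Fin n) :
    normalizedExtension x i = ‖x i‖⁻¹ • x i := by
  simp [normalizedExtension]

theorem norm_normalizedExtension {n : ℕ} {x : Fin n → X} (hx : ∀ i, x i ≠ 0) {i : ℕ}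
    (hi : i < n) : ‖normalizedExtension x i‖ = 1 := by
  rw [normalizedExtension, dif_pos hi, norm_smul, norm_inv, norm_norm,
    inv_mul_cancel₀ (norm_ne_zero_iff.2 (hx _))]

theorem norm_normalizedExtension_le {n : ℕ} {x : Fin n → X} (hx : ∀ i, x i ≠ 0) (i : ℕ) :
    ‖normalizedExtension x i‖ ≤ 1 := by
  by_cases hi : i < n
  · exact (norm_normalizedExtension hx hi).le
  · simp [normalizedExtension, hi]

theorem exists_sum_eq_of_mem_span {n : ℕ} (x : Fin n → X) (P : ℕ → Prop) [DecidablePred P] {u : X}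
    (hu : u ∈ Submodule.span ℝ (normalizedExtension x '' {i | P i})) :
    ∃ c : Fin n → ℝ, ∑ i ∈ Finset.univ.filter (fun i : Fin n => P i), c i • x i = u := by
  induction hu using Submodule.span_induction with
  | mem u hu =>
    obtain ⟨i, hi, rfl⟩ := hu
    by_cases h : i < n
    · refine ⟨Pi.single ⟨i, h⟩ ‖x ⟨i, h⟩‖⁻¹, ?_⟩
      rw [Finset.sum_eq_single_of_mem ⟨i, h⟩ (by simpa using hi)]
      · simp [normalizedExtension, h]
      · intro j _ hj
        simp [hj]
    · exact ⟨0, by simp [normalizedExtension, h]⟩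
  | zero => exact ⟨0, by simp⟩
  | add u v _ _ hu hv =>
    obtain ⟨c, rfl⟩ := hu
    obtain ⟨d, rfl⟩ := hv
    exact ⟨c + d, by simp [add_smul, Finset.sum_add_distrib]⟩
  | smul a u _ hu =>
    obtain ⟨c, rfl⟩ := hu
    exact ⟨a • c, by simp [mul_smul, Finset.smul_sum]⟩

theorem IsBasicWithFin.isSpanBasic {n : ℕ} {x : Fin n → X} (hx : IsBasicWithFin lam x) :
    IsSpanBasic lam (normalizedExtension x) := by
  intro p u hu v hv
  obtain ⟨c, rfl⟩ := exists_sum_eq_of_mem_span x (fun i => i < p) hu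
  obtain ⟨d, rfl⟩ := exists_sum_eq_of_mem_span x (fun i => ¬ i < p)
    (by simpa only [not_lt, Set.Ici_def] using hv)
  have key := hx (fun i => if (i : ℕ) < p then c i else d i) (min p n) (min_le_right _ _)
  have h1 : (Finset.univ.filter fun i : Fin n => (i : ℕ) < min p n) =
      Finset.univ.filter fun i : Fin n => (i : ℕ) < p := by
    ext i
    simp
  rw [h1, ← Finset.sum_filter_add_sum_filter_not Finset.univ (fun i : Fin n => (i : ℕ) < p)] at key
  rw [Finset.sum_congr rfl fun i hi => by rw [if_pos (Finset.mem_filter.1 hi).2],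
    Finset.sum_congr (s₁ := Finset.univ.filter fun i : Fin n => ¬ (i : ℕ) < p) rfl
      fun i hi => by rw [if_neg (Finset.mem_filter.1 hi).2]] at key
  exact key

/-- Coefficients with respect to a normalized basic sequence are controlled by the norm. -/
theorem IsSpanBasic.norm_coeff_le (hy : IsSpanBasic lam y) (hlam : 0 ≤ lam) {k : ℕ}
    {a : Fin k → ℕ} (ha : StrictMono a) (hnorm : ∀ i, ‖y (a i)‖ = 1) (c : Fin k → ℝ) :
    ‖c‖ ≤ 2 * lam * ‖∑ i, c i • y (a i)‖ := by
  refine (pi_norm_le_iff_of_nonneg (by positivity)).2 fun l => ?_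
  have hmem : ∀ (s : Set ℕ) (F : Finset (Fin k)), (∀ i ∈ F, a i ∈ s) →
      ∑ i ∈ F, c i • y (a i) ∈ Submodule.span ℝ (y '' s) := fun s F h =>
    Submodule.sum_mem _ fun i hi => Submodule.smul_mem _ _
      (Submodule.subset_span ⟨a i, h i hi, rfl⟩)
  have hlt := hy (a l) _ (hmem _ {i | i < l} (by simp [ha.lt_iff_lt])) _
    (hmem _ {i | ¬ i < l} (by simp [ha.le_iff_le]))
  have hle := hy (a l + 1) _ (hmem _ {i | i ≤ l} (by simp [ha.le_iff_le])) _
    (hmem _ {i | ¬ i ≤ l} (by simp [ha.lt_iff_lt]))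
  rw [Finset.sum_filter_add_sum_filter_not] at hlt hle
  have hset : (Finset.univ.filter fun i => i ≤ l) =
      insert l (Finset.univ.filter fun i => i < l) := by
    ext i
    simp [le_iff_eq_or_lt]
  rw [hset, Finset.sum_insert (by simp)] at hle
  calc ‖c l‖ = ‖c l • y (a l)‖ := by rw [norm_smul, hnorm, mul_one]
    _ ≤ ‖c l • y (a l) + ∑ i with i < l, c i • y (a i)‖ + ‖∑ i with i < l, c i • y (a i)‖ := by
        simpa using norm_sub_le (c l • y (a l) + ∑ i with i < l, c i • y (a i))
          (∑ i with i < l, c i • y (a i))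
    _ ≤ _ := by linarith

/-- In a uniformly convex space, blocks of a bounded basic sequence have small convex
combinations. -/
theorem exists_small_convexCombination [UniformConvexSpace X] (hlam : 1 ≤ lam) {η : ℝ}
    (hη : 0 < η) :
    ∃ N : ℕ, 0 < N ∧ ∀ y : ℕ → X, IsSpanBasic lam y → (∀ i, ‖y i‖ ≤ 1) →
      ∀ a : ℕ, ∃ z ∈ convexHull ℝ (y '' Set.Ico a (a + N)), ‖z‖ ≤ η := by
  obtain ⟨δ, hδ, h⟩ := exists_forall_closed_ball_dist_add_le_two_sub X
    (div_pos hη (zero_lt_one.trans_le hlam))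
  set q := max 0 (1 - δ / 2) with hq
  have hq0 : 0 ≤ q := le_max_left _ _
  have hq1 : q < 1 := max_lt one_pos (by linarith)
  have key : ∀ m : ℕ, ∀ y : ℕ → X, IsSpanBasic lam y → (∀ i, ‖y i‖ ≤ 1) →
      ∀ a : ℕ, ∃ z ∈ convexHull ℝ (y '' Set.Ico a (a + 2 ^ m)), ‖z‖ ≤ max η (q ^ m) := by
    intro m y hy hy1
    induction m with
    | zero =>
      exact fun a => ⟨y a, subset_convexHull _ _ ⟨a, by simp, rfl⟩, by simp [hy1 a]⟩
    | succ m ih =>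
      intro a
      obtain ⟨u, hu, hur⟩ := ih a
      obtain ⟨v, hv, hvr⟩ := ih (a + 2 ^ m)
      have hu' : u ∈ convexHull ℝ (y '' Set.Ico a (a + 2 ^ (m + 1))) :=
        convexHull_mono (Set.image_mono (Set.Ico_subset_Ico le_rfl (by rw [pow_succ]; omega))) hu
      have hv' : v ∈ convexHull ℝ (y '' Set.Ico a (a + 2 ^ (m + 1))) :=
        convexHull_mono (Set.image_mono
          (Set.Ico_subset_Ico (Nat.le_add_right _ _) (by rw [pow_succ]; omega))) hv
      by_cases huη : ‖u‖ ≤ η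
      · exact ⟨u, hu', huη.trans (le_max_left _ _)⟩
      by_cases hr : q ^ m ≤ η
      · exact ⟨u, hu', hur.trans (max_le (le_max_left _ _) (hr.trans (le_max_left _ _)))⟩
      push Not at huη hr
      rw [max_eq_right hr.le] at hur hvr
      have hr0 : 0 < q ^ m := hη.trans hr
      have hr1 : q ^ m ≤ 1 := pow_le_one₀ hq0 hq1.le
      refine ⟨midpoint ℝ u v, (convex_convexHull ℝ _).midpoint_mem hu' hv',
        le_max_of_le_right ?_⟩
      have husp : u ∈ Submodule.span ℝ (y '' Set.Iio (a + 2 ^ m)) :=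
        Submodule.span_mono (Set.image_mono Set.Ico_subset_Iio_self)
          (convexHull_min Submodule.subset_span (Submodule.convex _) hu)
      have hvsp : v ∈ Submodule.span ℝ (y '' Set.Ici (a + 2 ^ m)) :=
        Submodule.span_mono (Set.image_mono Set.Ico_subset_Ici_self)
          (convexHull_min Submodule.subset_span (Submodule.convex _) hv)
      have hsep : η / lam ≤ ‖u - v‖ := by
        have := hy _ u husp (-v) (Submodule.neg_mem _ hvsp)
        rw [← sub_eq_add_neg] at this
        rw [div_le_iff₀' (by linarith)]
        linarith
      have hscale : ∀ w : X, ‖(q ^ m)⁻¹ • w‖ = (q ^ m)⁻¹ * ‖w‖ := fun w => by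
        rw [norm_smul, Real.norm_of_nonneg (inv_nonneg.2 hr0.le)]
      have hsum := @h ((q ^ m)⁻¹ • u) (by rw [hscale, inv_mul_le_one₀ hr0]; exact hur)
        ((q ^ m)⁻¹ • v) (by rw [hscale, inv_mul_le_one₀ hr0]; exact hvr)
        (by
          rw [← smul_sub, hscale]
          exact hsep.trans (le_mul_of_one_le_left (norm_nonneg _) ((one_le_inv₀ hr0).2 hr1)))
      rw [← smul_add, hscale, inv_mul_le_iff₀ hr0] at hsum
      rw [midpoint_eq_smul_add, norm_smul, invOf_eq_inv, norm_inv, Real.norm_two, pow_succ]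
      have : q ^ m * (1 - δ / 2) ≤ q ^ m * q := by gcongr; exact le_max_right _ _
      linarith
  obtain ⟨m, hm⟩ := exists_pow_lt_of_lt_one hη hq1
  refine ⟨2 ^ m, by positivity, fun y hy hy1 a => ?_⟩
  obtain ⟨z, hz, hzn⟩ := key m y hy hy1 a
  exact ⟨z, hz, hzn.trans (max_le le_rfl hm.le)⟩

theorem norm_sum_smul_le {k : ℕ} {v : Fin k → X} {r : ℝ} (hv : ∀ i, ‖v i‖ ≤ r)
    (c : Fin k → ℝ) (F : Finset (Fin k)) (hr : 0 ≤ r) :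
    ‖∑ i ∈ F, c i • v i‖ ≤ k * r * ‖c‖ := by
  calc ‖∑ i ∈ F, c i • v i‖ ≤ ∑ i ∈ F, ‖c i • v i‖ := norm_sum_le _ _
    _ ≤ ∑ i ∈ F, r * ‖c‖ := Finset.sum_le_sum fun i _ => by
        rw [norm_smul, mul_comm]
        exact mul_le_mul (hv i) (norm_le_pi_norm c i) (norm_nonneg _) hr
    _ ≤ ∑ i : Fin k, r * ‖c‖ :=
        Finset.sum_le_sum_of_subset_of_nonneg (Finset.subset_univ _) fun _ _ _ => by positivity
    _ = k * r * ‖c‖ := by simp [mul_assoc]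

/-- The `k`-tuples in the unit ball can be colored by finitely many colors so that tuples of the
same color span almost isometric copies of `ℝ^k`. -/
theorem exists_norm_coloring (X : Type*) [NormedAddCommGroup X] [NormedSpace ℝ X] (k : ℕ) {θ : ℝ}
    (hθ : 0 < θ) :
    ∃ (κ : Type) (_ : Finite κ) (Φ : (Fin k → X) → κ), ∀ v w : Fin k → X,
      (∀ i, ‖v i‖ ≤ 1) → (∀ i, ‖w i‖ ≤ 1) → Φ v = Φ w → ∀ c : Fin k → ℝ,
        ‖∑ i, c i • v i‖ ≤ ‖∑ i, c i • w i‖ + θ * ‖c‖ := by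
  set τ := θ / (2 * k + 1) with hτ
  have hτ0 : 0 < τ := by positivity
  obtain ⟨G, hGs, hGf, hG⟩ :=
    (isCompact_closedBall (0 : Fin k → ℝ) 1).finite_cover_balls hτ0
  have := hGf.to_subtype
  have hlt : ∀ t : ℝ, min ⌊t / τ⌋₊ ⌊k / τ⌋₊ < ⌊k / τ⌋₊ + 1 := fun t =>
    Nat.lt_succ_of_le (min_le_right _ _)
  refine ⟨G → Fin (⌊k / τ⌋₊ + 1), inferInstance,
    fun v g => ⟨min ⌊‖∑ i, g.1 i • v i‖ / τ⌋₊ ⌊k / τ⌋₊, hlt _⟩, fun v w hv hw hvw => ?_⟩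
  have hbound : ∀ u : Fin k → X, (∀ i, ‖u i‖ ≤ 1) → ∀ c : Fin k → ℝ,
      ‖∑ i, c i • u i‖ ≤ k * ‖c‖ := fun u hu c => by
    simpa using norm_sum_smul_le hu c Finset.univ zero_le_one
  have hnet : ∀ g ∈ G, ‖∑ i, g i • v i‖ ≤ ‖∑ i, g i • w i‖ + τ := by
    intro g hg
    have hg1 : ‖g‖ ≤ 1 := by simpa using hGs hg
    have hfloor : ∀ u : Fin k → X, (∀ i, ‖u i‖ ≤ 1) →
        min ⌊‖∑ i, g i • u i‖ / τ⌋₊ ⌊k / τ⌋₊ = ⌊‖∑ i, g i • u i‖ / τ⌋₊ := fun u hu => by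
      refine min_eq_left (Nat.floor_mono ?_)
      gcongr
      exact (hbound u hu g).trans (mul_le_of_le_one_right (Nat.cast_nonneg _) hg1)
    have heq := congrArg Fin.val (congrFun hvw ⟨g, hg⟩)
    simp only [hfloor v hv, hfloor w hw] at heq
    have h1 := Nat.lt_floor_add_one (‖∑ i, g i • v i‖ / τ)
    have h2 := Nat.floor_le (div_nonneg (norm_nonneg (∑ i, g i • w i)) hτ0.le)
    rw [heq, div_lt_iff₀ hτ0] at h1
    rw [le_div_iff₀ hτ0] at h2
    linarith
  have hunit : ∀ c : Fin k → ℝ, ‖c‖ ≤ 1 → ‖∑ i, c i • v i‖ ≤ ‖∑ i, c i • w i‖ + θ := by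
    intro c hc
    obtain ⟨g, hg, hcg⟩ := Set.mem_iUnion₂.1 (hG (mem_closedBall_zero_iff.2 hc))
    rw [Metric.mem_ball, dist_eq_norm] at hcg
    have hdiff : ∀ u : Fin k → X, (∀ i, ‖u i‖ ≤ 1) →
        ‖∑ i, c i • u i - ∑ i, g i • u i‖ ≤ k * τ := fun u hu => by
      rw [← Finset.sum_sub_distrib]
      simp only [← sub_smul]
      exact (hbound u hu (c - g)).trans (by gcongr)
    have h1 := norm_le_norm_add_norm_sub' (∑ i, c i • v i) (∑ i, g i • v i)
    have h2 := norm_le_norm_add_norm_sub (∑ i, c i • w i) (∑ i, g i • w i)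
    have h3 : (2 * k + 1) * τ = θ := by rw [hτ]; field_simp
    linarith [hnet g hg, hdiff v hv, hdiff w hw]
  intro c
  rcases eq_or_ne c 0 with rfl | hc
  · simp
  have hc0 : 0 < ‖c‖ := norm_pos_iff.2 hc
  have h := hunit (‖c‖⁻¹ • c) (by rw [norm_smul, norm_inv, norm_norm, inv_mul_cancel₀ hc0.ne'])
  simp only [Pi.smul_apply, smul_assoc, ← Finset.smul_sum] at h
  rw [norm_smul, norm_smul, norm_inv, norm_norm, ← le_div_iff₀' (by positivity), div_inv_eq_mul,
    add_mul] at h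
  calc _ ≤ _ := h
    _ = _ := by field_simp

/-- If the norm of a linear combination is bounded for all choices of one vector per block, then
it is bounded for all choices of one convex combination per block. -/
theorem norm_sum_smul_le_of_mem_convexHull {k : ℕ} {B : Fin k → Set X} {c : Fin k → ℝ} {R : ℝ}
    (h : ∀ v : Fin k → X, (∀ i, v i ∈ B i) → ‖∑ i, c i • v i‖ ≤ R)
    {v : Fin k → X} (hv : ∀ i, v i ∈ convexHull ℝ (B i)) : ‖∑ i, c i • v i‖ ≤ R := by
  let L : (Fin k → X) →ₗ[ℝ] X := ∑ i, c i • LinearMap.proj i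
  have hL : ∀ v, L v = ∑ i, c i • v i := fun v => by simp [L]
  have hconv : Convex ℝ (L ⁻¹' Metric.closedBall 0 R) :=
    (convex_closedBall 0 R).linear_preimage L
  have hsub : convexHull ℝ (Set.univ.pi B) ⊆ L ⁻¹' Metric.closedBall 0 R :=
    convexHull_min (fun v hv => by simpa [hL] using h v fun i => hv i trivial) hconv
  rw [convexHull_pi] at hsub
  simpa [hL] using hsub (fun i _ => hv i : v ∈ Set.univ.pi fun i => convexHull ℝ (B i))

/-- A basic sequence whose tuples, one entry per block, are almost isometrically equivalent and
whose blocks admit small convex combinations is almost suppression unconditional. -/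
theorem norm_sum_le_of_blocks {k N : ℕ} (hN : 0 < N) {θ η : ℝ} (hη : 0 ≤ η)
    (hspread : ∀ a b : Fin k → ℕ, (∀ i : Fin k, a i ∈ Set.Ico (i * N) (i * N + N : ℕ)) →
      (∀ i : Fin k, b i ∈ Set.Ico (i * N) (i * N + N : ℕ)) → ∀ c : Fin k → ℝ,
        ‖∑ i, c i • y (a i)‖ ≤ ‖∑ i, c i • y (b i)‖ + θ * ‖c‖)
    (hsmall : ∀ a : ℕ, ∃ z ∈ convexHull ℝ (y '' Set.Ico a (a + N)), ‖z‖ ≤ η)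
    (c : Fin k → ℝ) (F : Finset (Fin k)) :
    ‖∑ i ∈ F, c i • y (i * N)‖ ≤ ‖∑ i, c i • y (i * N)‖ + (θ + k * η) * ‖c‖ := by
  choose z hz hzη using hsmall
  have hstart : ∀ i : Fin k, (i * N : ℕ) ∈ Set.Ico (i * N) (i * N + N : ℕ) := fun i =>
    ⟨le_rfl, by omega⟩
  have hR : ∀ v : Fin k → X, (∀ i : Fin k, v i ∈ y '' Set.Ico (i * N) (i * N + N : ℕ)) →
      ‖∑ i, c i • v i‖ ≤ ‖∑ i, c i • y (i * N)‖ + θ * ‖c‖ := by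
    intro v hv
    choose a ha hav using hv
    simpa only [hav] using hspread a (fun i => i * N) ha hstart c
  have key := norm_sum_smul_le_of_mem_convexHull hR
    (v := fun i => if i ∈ F then y (i * N) else z (i * N)) (fun i => by
      split_ifs
      · exact subset_convexHull _ _ ⟨_, hstart i, rfl⟩
      · exact hz _)
  have hsplit : ∑ i, c i • (if i ∈ F then y (i * N) else z (i * N)) =
      ∑ i ∈ F, c i • y (i * N) + ∑ i ∈ Fᶜ, c i • z (i * N) := by
    rw [← Finset.sum_add_sum_compl F]
    congr 1 <;> refine Finset.sum_congr rfl fun i hi => ?_ <;> simp_all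
  rw [hsplit] at key
  have htail := norm_sum_smul_le (v := fun i : Fin k => z (i * N)) (fun i => hzη _) c Fᶜ hη
  have htri := norm_le_add_norm_add (∑ i ∈ F, c i • y (i * N)) (∑ i ∈ Fᶜ, c i • z (i * N))
  linarith

/-- Suppression unconditionality is invariant under rescaling of the vectors. -/
theorem IsSuppUnconditionalFin.of_smul {β : ℝ} {k : ℕ} {v : Fin k → X} {r : Fin k → ℝ}
    (hr : ∀ i, r i ≠ 0) (h : IsSuppUnconditionalFin β fun i => r i • v i) :
    IsSuppUnconditionalFin β v := by
  intro c F
  simpa [smul_smul, hr] using h (fun i => c i * (r i)⁻¹) F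

end

/-- (Corollary 3.9.) -/
theorem statement9
    {X : Type*} [NormedAddCommGroup X] [NormedSpace ℝ X] [CompleteSpace X]
    [UniformConvexSpace X]
    (lam ε : ℝ) (hlam : 1 ≤ lam) (hε : 0 < ε) (k : ℕ) :
    ∃ n : ℕ, k ≤ n ∧ ∀ x : Fin n → X, (∀ i, x i ≠ 0) → IsBasicWithFin lam x →
      ∃ j : Fin k → Fin n, StrictMono j ∧
        IsSuppUnconditionalFin (1 + ε) fun i => x (j i) := by
  have hlam0 : 0 < lam := zero_lt_one.trans_le hlam
  set θ := ε / (4 * lam) with hθ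
  set η := ε / (4 * lam * (k + 1)) with hη
  have hθ0 : 0 < θ := by positivity
  have hη0 : 0 < η := by positivity
  obtain ⟨N, hN, hsmall⟩ := exists_small_convexCombination (X := X) hlam hη0
  obtain ⟨κ, _, Φ, hΦ⟩ := exists_norm_coloring X k hθ0
  obtain ⟨n, hn⟩ := exists_homogeneous (κ := κ) k (k * N)
  refine ⟨max n k, le_max_right _ _, fun x hx0 hx => ?_⟩
  set y := normalizedExtension x
  obtain ⟨T, hTS, hT, col, hcol⟩ := hn (fun a => Φ (y ∘ a)) (Finset.range (max n k)) (by simp)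
  have hTlt : ∀ t ∈ T, t < max n k := fun t ht => Finset.mem_range.1 (hTS ht)
  obtain ⟨e, he, heT⟩ : ∃ e : ℕ → ℕ, StrictMono e ∧ ∀ i < k * N, e i ∈ T := by
    refine ⟨fun i => if h : i < k * N then T.orderEmbOfFin hT ⟨i, h⟩ else max n k + i, ?_, ?_⟩
    · intro i j hij
      by_cases hj : j < k * N
      · simp [hj, hij.trans hj, hij]
      · by_cases hi : i < k * N
        · have := hTlt _ (T.orderEmbOfFin_mem hT ⟨i, hi⟩)
          simp only [hi, hj, dite_true, dite_false]
          omega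
        · simp [hi, hj, hij]
    · intro i hi
      simp only [hi, dite_true]
      exact T.orderEmbOfFin_mem hT _
  have hblock : ∀ (i : Fin k) (t : ℕ), t ∈ Set.Ico (i * N) (i * N + N : ℕ) → t < k * N := by
    intro i t ht
    have : (i + 1 : ℕ) * N ≤ k * N := Nat.mul_le_mul_right N i.2
    linarith [ht.2]
  have hmono : ∀ a : Fin k → ℕ, (∀ i : Fin k, a i ∈ Set.Ico (i * N) (i * N + N : ℕ)) →
      StrictMono a := by
    intro a ha i j hij
    have : (i + 1 : ℕ) * N ≤ j * N := Nat.mul_le_mul_right N hij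
    linarith [(ha i).2, (ha j).1]
  have hstart : ∀ i : Fin k, (i * N : ℕ) ∈ Set.Ico (i * N) (i * N + N : ℕ) := fun i =>
    ⟨le_rfl, by omega⟩
  have hy1 : ∀ i, ‖y i‖ ≤ 1 := norm_normalizedExtension_le hx0
  have hbasic : IsSpanBasic lam (y ∘ e) := hx.isSpanBasic.comp_strictMono he
  have hmem : ∀ i : Fin k, e (i * N) ∈ T := fun i => heT _ (hblock i _ (hstart i))
  have hsupp : IsSuppUnconditionalFin (1 + ε) fun i : Fin k => (y ∘ e) (i * N) := by
    intro c F
    have hF := norm_sum_le_of_blocks (y := y ∘ e) hN hη0.le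
      (fun a b ha hb => hΦ _ _ (fun _ => hy1 _) (fun _ => hy1 _)
        ((hcol (e ∘ a) (he.comp (hmono a ha)) fun i => heT _ (hblock i _ (ha i))).trans
          (hcol (e ∘ b) (he.comp (hmono b hb)) fun i => heT _ (hblock i _ (hb i))).symm))
      (hsmall _ hbasic fun _ => hy1 _) c F
    have hc := hbasic.norm_coeff_le hlam0.le (hmono _ hstart)
      (fun i => norm_normalizedExtension hx0 (hTlt _ (hmem i))) c
    have hconst : (θ + k * η) * (2 * lam) ≤ ε := by
      have hk : k * η ≤ θ := by
        rw [hη, hθ, ← div_div, mul_div_assoc', div_le_iff₀ (by positivity)]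
        nlinarith
      have : 4 * lam * θ = ε := by rw [hθ]; field_simp
      nlinarith
    have : (θ + k * η) * ‖c‖ ≤ ε * ‖∑ i : Fin k, c i • (y ∘ e) (i * N)‖ :=
      calc (θ + k * η) * ‖c‖
          ≤ (θ + k * η) * (2 * lam * ‖∑ i : Fin k, c i • (y ∘ e) (i * N)‖) := by gcongr
        _ = (θ + k * η) * (2 * lam) * ‖∑ i : Fin k, c i • (y ∘ e) (i * N)‖ := by ring
        _ ≤ _ := by gcongr
    linarith
  refine ⟨fun i => ⟨e (i * N), hTlt _ (hmem i)⟩, fun i j hij => he (hmono _ hstart hij), ?_⟩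
  refine IsSuppUnconditionalFin.of_smul (r := fun i => ‖x ⟨e (i * N), hTlt _ (hmem i)⟩‖⁻¹)
    (fun i => inv_ne_zero (norm_ne_zero_iff.2 (hx0 _))) ?_
  convert hsupp using 2 with i
  exact (normalizedExtension_val x ⟨e (i * N), hTlt _ (hmem i)⟩).symm

end
end
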